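/- arXiv:2303.07279 — 5 statements merged into one kernel-verified Lean document; each statement's English description precedes it below -/
import Mathlib

section
/- Let n ≥ 1 and let A ⊆ ℝⁿ be a nonempty closed set. Then the minimax regret over A for sequential probability assignment under logarithmic loss admits Shtarkov's integral expression: the infimum, over all measurable probability densities q on ℝⁿ with respect to Lebesgue measure, of sup_{y ∈ ℝⁿ} [ −dist(y,A)²/2 − log q(y) − (n/2)·log(2π) ] equals log( (2π)^{−n/2} ∫_{ℝⁿ} exp(−dist(y,A)²/2) dy ), where both sides take values in (−∞, +∞]. -/
open MeasureTheory ENNReal Real Set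

noncomputable section

/-- Any density `q` has worst-case log-ratio against `g` at least `log (∫ g)`. -/
theorem log_lintegral_le_iSup_log_sub_log {α : Type*} [MeasurableSpace α] {μ : Measure α}
    {g q : α → ℝ≥0∞} (hq : Measurable q) (hq1 : ∫⁻ y, q y ∂μ = 1) :
    ENNReal.log (∫⁻ y, g y ∂μ) ≤ ⨆ y, (ENNReal.log (g y) - ENNReal.log (q y)) := by
  set v : EReal := ⨆ y, (ENNReal.log (g y) - ENNReal.log (q y)) with hv
  rcases eq_or_ne v ⊤ with h | hvtop
  · simp [h]
  have hfin : ∀ᵐ y ∂μ, q y < ⊤ := ae_lt_top hq (by simp [hq1])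
  have hle : ∀ᵐ y ∂μ, g y ≤ EReal.exp v * q y := by
    filter_upwards [hfin] with y hy
    have h1 : ENNReal.log (g y) - ENNReal.log (q y) ≤ v :=
      le_iSup (fun y => ENNReal.log (g y) - ENNReal.log (q y)) y
    have h2 : ENNReal.log (g y) ≤ v + ENNReal.log (q y) :=
      (EReal.sub_le_iff_le_add (Or.inr hvtop)
        (Or.inl fun h => hy.ne (ENNReal.log_eq_top_iff.1 h))).1 h1
    rw [← ENNReal.log_le_log_iff, ENNReal.log_mul_add, EReal.log_exp]
    exact h2
  have h := lintegral_mono_ae hle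
  rw [lintegral_const_mul _ hq, hq1, mul_one] at h
  rw [← EReal.log_exp v]
  exact ENNReal.log_monotone h

/-- Shtarkov's formula for an arbitrary positive finite maximum-likelihood envelope `g`. -/
theorem iInf_iSup_log_sub_log_eq_log_lintegral {α : Type*} [MeasurableSpace α] {μ : Measure α}
    (hμ : μ ≠ 0) {g : α → ℝ≥0∞} (hg : Measurable g) (hg0 : ∀ y, g y ≠ 0)
    (hgtop : ∀ y, g y ≠ ⊤) :
    (⨅ q ∈ {q : α → ℝ≥0∞ | Measurable q ∧ ∫⁻ y, q y ∂μ = 1},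
        ⨆ y, (ENNReal.log (g y) - ENNReal.log (q y))) = ENNReal.log (∫⁻ y, g y ∂μ) := by
  refine le_antisymm ?_ (le_iInf₂ fun q hq => log_lintegral_le_iSup_log_sub_log hq.1 hq.2)
  set Z := ∫⁻ y, g y ∂μ with hZ
  rcases eq_or_ne Z ⊤ with h | hZtop
  · simp [h]
  have hZ0 : Z ≠ 0 := by
    rw [hZ, ← pos_iff_ne_zero, lintegral_pos_iff_support hg,
      show Function.support g = univ from eq_univ_of_forall hg0]
    simpa [pos_iff_ne_zero] using hμ
  refine iInf₂_le_of_le (fun y => g y * Z⁻¹) ⟨hg.mul_const _, ?_⟩ (iSup_le fun y => ?_)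
  · rw [lintegral_mul_const _ hg, ← hZ, ENNReal.mul_inv_cancel hZ0 hZtop]
  · rw [ENNReal.log_mul_add, ENNReal.log_inv]
    have h1 : ((ENNReal.log (g y)).toReal : EReal) = ENNReal.log (g y) :=
      EReal.coe_toReal (by simpa using hgtop y) (by simpa using hg0 y)
    have h2 : ((ENNReal.log Z).toReal : EReal) = ENNReal.log Z :=
      EReal.coe_toReal (by simpa using hZtop) (by simpa using hZ0)
    rw [← h1, ← h2]
    norm_cast
    apply le_of_eq
    ring

/-- Shtarkov's formula for the minimax regret of sequential probability assignment over the
Gaussian model `{N(θ, I_n) : θ ∈ A}`: the infimum over all measurable probability densities `q`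
on `ℝⁿ` (w.r.t. Lebesgue measure) of the worst-case regret
`sup_y [-dist(y,A)²/2 - log q(y) - (n/2)·log(2π)]` equals
`log((2π)^{-n/2} ∫ exp(-dist(y,A)²/2) dy)`, in the extended reals. -/
theorem shtarkov_minimax_regret (n : ℕ) (hn : 1 ≤ n)
    (A : Set (EuclideanSpace ℝ (Fin n))) (hA : A.Nonempty) (hAclosed : IsClosed A) :
    (⨅ q ∈ {q : EuclideanSpace ℝ (Fin n) → ℝ≥0∞ | Measurable q ∧ ∫⁻ y, q y = 1},
        ⨆ y : EuclideanSpace ℝ (Fin n),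
          (((-(Metric.infDist y A) ^ 2 / 2 - (n / 2 : ℝ) * Real.log (2 * π) : ℝ)) : EReal)
            - ENNReal.log (q y)) =
      ENNReal.log
        (∫⁻ y, ENNReal.ofReal
          ((2 * π) ^ (-(n : ℝ) / 2) * Real.exp (-(Metric.infDist y A) ^ 2 / 2))) := by
  have hg0 (y : EuclideanSpace ℝ (Fin n)) :
      0 < (2 * π) ^ (-(n : ℝ) / 2) * Real.exp (-(Metric.infDist y A) ^ 2 / 2) := by positivity
  rw [← iInf_iSup_log_sub_log_eq_log_lintegral (NeZero.ne volume) (by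
      have := (Metric.continuous_infDist_pt A).measurable
      fun_prop) (fun y => (ENNReal.ofReal_pos.2 (hg0 y)).ne') (fun y => ENNReal.ofReal_ne_top)]
  congr! 6 with q hq y
  rw [ENNReal.log_ofReal_of_pos (hg0 y), Real.log_mul (Real.rpow_pos_of_pos (by positivity) _).ne' (Real.exp_ne_zero _),
    Real.log_exp, Real.log_rpow (by positivity)]
  congr 1
  ring
end
end

section
/- (Comparison inequality for the Wills functional.) Let A ⊆ ℝᵐ and B ⊆ ℝⁿ be nonempty sets, and suppose there exists a map φ : A → B with φ(A) = B such that ‖φ(θ) − φ(θ')‖ ≤ ‖θ − θ'‖ for all θ, θ' ∈ A. Then ∫_{ℝᵐ} exp(−π·dist(x,A)²) dx ≥ ∫_{ℝⁿ} exp(−π·dist(x,B)²) dx, where both integrals take values in [0, +∞]. -/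
open MeasureTheory ENNReal Real Set

noncomputable section

/-- The Wills functional `W(A) = ∫_{ℝⁿ} exp(-π·dist(x,A)²) dx ∈ [0,∞]`. -/
def wills (n : ℕ) (A : Set (EuclideanSpace ℝ (Fin n))) : ℝ≥0∞ :=
  ∫⁻ x, ENNReal.ofReal (Real.exp (-π * (Metric.infDist x A) ^ 2))

section PowerSum

variable {ι : Type*} [Fintype ι]

/-- The power `(∑ j, exp (y j)) ^ r` of a sum of exponentials. -/
def expSumPow (r : ℝ) (y : ι → ℝ) : ℝ := (∑ j, Real.exp (y j)) ^ r

/-- The Gibbs weights `exp (y i) / ∑ j, exp (y j)`. -/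
def gibbs (y : ι → ℝ) (i : ι) : ℝ := Real.exp (y i) / ∑ j, Real.exp (y j)

theorem expSumPow_nonneg (r : ℝ) (y : ι → ℝ) : 0 ≤ expSumPow r y :=
  Real.rpow_nonneg (Finset.sum_nonneg fun _ _ => (Real.exp_pos _).le) _

theorem gibbs_nonneg (y : ι → ℝ) (i : ι) : 0 ≤ gibbs y i :=
  div_nonneg (Real.exp_pos _).le (Finset.sum_nonneg fun _ _ => (Real.exp_pos _).le)

theorem gibbs_le_one (y : ι → ℝ) (i : ι) : gibbs y i ≤ 1 :=
  div_le_one_of_le₀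
    (Finset.single_le_sum (f := fun j => Real.exp (y j)) (fun _ _ => (Real.exp_pos _).le)
      (Finset.mem_univ i))
    (Finset.sum_nonneg fun _ _ => (Real.exp_pos _).le)

variable [Nonempty ι]

theorem sum_exp_pos (y : ι → ℝ) : 0 < ∑ j, Real.exp (y j) :=
  Finset.sum_pos (fun _ _ => Real.exp_pos _) Finset.univ_nonempty

theorem sum_gibbs (y : ι → ℝ) : ∑ i, gibbs y i = 1 := by
  simp only [gibbs, ← Finset.sum_div]
  exact div_self (sum_exp_pos y).ne'

theorem continuous_expSumPow (r : ℝ) : Continuous (expSumPow r : (ι → ℝ) → ℝ) :=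
  Continuous.rpow_const (by fun_prop) fun y => Or.inl (sum_exp_pos y).ne'

theorem continuous_gibbs (i : ι) : Continuous fun y : ι → ℝ => gibbs y i :=
  Continuous.div (by fun_prop) (by fun_prop) fun y => (sum_exp_pos y).ne'

variable {y : ℝ → ι → ℝ} {y' : ι → ℝ} {t : ℝ}

theorem hasDerivAt_expSumPow (r : ℝ) (h : ∀ i, HasDerivAt (fun s => y s i) (y' i) t) :
    HasDerivAt (fun s => expSumPow r (y s))
      (r * expSumPow r (y t) * ∑ i, gibbs (y t) i * y' i) t := by
  have hpos := sum_exp_pos (y t)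
  have h1 : HasDerivAt (fun s => ∑ j, Real.exp (y s j)) (∑ j, Real.exp (y t j) * y' j) t :=
    HasDerivAt.fun_sum fun j _ => (h j).exp
  refine (h1.rpow_const (p := r) (Or.inl hpos.ne')).congr_deriv ?_
  rw [Real.rpow_sub_one hpos.ne']
  simp only [expSumPow, gibbs, div_mul_eq_mul_div, ← Finset.sum_div]
  ring

theorem hasDerivAt_gibbs (h : ∀ i, HasDerivAt (fun s => y s i) (y' i) t) (i : ι) :
    HasDerivAt (fun s => gibbs (y s) i)
      (gibbs (y t) i * (y' i - ∑ j, gibbs (y t) j * y' j)) t := by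
  have hpos := sum_exp_pos (y t)
  have h1 : HasDerivAt (fun s => ∑ j, Real.exp (y s j)) (∑ j, Real.exp (y t j) * y' j) t :=
    HasDerivAt.fun_sum fun j _ => (h j).exp
  refine ((h i).exp.div h1 hpos.ne').congr_deriv ?_
  simp only [gibbs, div_mul_eq_mul_div, ← Finset.sum_div]
  field_simp

theorem hasDerivAt_expSumPow_mul_gibbs (r : ℝ) (h : ∀ i, HasDerivAt (fun s => y s i) (y' i) t)
    (i : ι) :
    HasDerivAt (fun s => expSumPow r (y s) * gibbs (y s) i)
      (expSumPow r (y t) * gibbs (y t) i * (y' i - (1 - r) * ∑ j, gibbs (y t) j * y' j)) t :=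
  ((hasDerivAt_expSumPow r h).mul (hasDerivAt_gibbs h i)).congr_deriv (by ring)

end PowerSum

section Gaussian

variable {E : Type*} [NormedAddCommGroup E] {ι : Type*}

/-- The exponents `-(q * π * ‖x - p i‖ ^ 2)`. -/
def gaussExponent (q : ℝ) (p : ι → E) (x : E) (i : ι) : ℝ := -(q * π * ‖x - p i‖ ^ 2)

theorem continuous_gaussExponent (q : ℝ) (p : ι → E) : Continuous (gaussExponent q p) := by
  unfold gaussExponent
  fun_prop

theorem hasDerivAt_gaussExponent [InnerProductSpace ℝ E] (q : ℝ)
    {p : ℝ → ι → E} {p' : E} {x : ℝ → E} {x' : E} {t : ℝ} {i : ι}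
    (hp : HasDerivAt (fun s => p s i) p' t) (hx : HasDerivAt x x' t) :
    HasDerivAt (fun s => gaussExponent q (p s) (x s) i)
      (2 * q * π * inner ℝ (x t - p t i) (p' - x')) t := by
  have : HasDerivAt (fun s => gaussExponent q (p s) (x s) i) _ t :=
    ((hx.fun_sub hp).norm_sq.const_mul (q * π)).fun_neg
  refine this.congr_deriv ?_
  rw [← neg_sub x' p', inner_neg_right]
  ring

variable [Fintype ι]

/-- The integrand `(∑ i, exp (-(q * π * ‖x - p i‖ ^ 2))) ^ q⁻¹`, which approximates
`max i, exp (-(π * ‖x - p i‖ ^ 2))` for large `q`. -/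
def softWills (q : ℝ) (p : ι → E) (x : E) : ℝ := expSumPow q⁻¹ (gaussExponent q p x)

/-- The weight of the `i`-th Gaussian in `softWills`. -/
def softWeight (q : ℝ) (p : ι → E) (x : E) (i : ι) : ℝ := gibbs (gaussExponent q p x) i

theorem softWills_nonneg (q : ℝ) (p : ι → E) (x : E) : 0 ≤ softWills q p x :=
  expSumPow_nonneg _ _

theorem exp_le_softWills {q : ℝ} (hq : 0 < q) (p : ι → E) (x : E) (i : ι) :
    Real.exp (-(π * ‖x - p i‖ ^ 2)) ≤ softWills q p x := by
  have h1 : Real.exp (gaussExponent q p x i) ≤ ∑ j, Real.exp (gaussExponent q p x j) :=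
    Finset.single_le_sum (f := fun j => Real.exp (gaussExponent q p x j))
      (fun _ _ => (Real.exp_pos _).le) (Finset.mem_univ i)
  calc Real.exp (-(π * ‖x - p i‖ ^ 2)) = Real.exp (gaussExponent q p x i) ^ q⁻¹ := by
        rw [← Real.exp_mul, gaussExponent]
        congr 1
        field_simp
    _ ≤ _ := Real.rpow_le_rpow (Real.exp_pos _).le h1 (inv_nonneg.2 hq.le)

theorem abs_softWeight_le_one (q : ℝ) (p : ι → E) (x : E) (i : ι) : |softWeight q p x i| ≤ 1 := by
  rw [softWeight, abs_of_nonneg (gibbs_nonneg _ _)]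
  exact gibbs_le_one _ _

theorem sum_sum_mul_inner_nonpos [InnerProductSpace ℝ E] {w : ι → ℝ}
    (hw : ∀ i, 0 ≤ w i) {p v : ι → E}
    (h : ∀ i j, inner ℝ (p i - p j) (v i - v j) ≤ 0) :
    ∑ i, ∑ j, w i * w j * inner ℝ (p i - p j) (v i) ≤ 0 := by
  have h1 : ∑ i, ∑ j, w i * w j * inner ℝ (p i - p j) (v i) =
      ∑ i, ∑ j, w i * w j * inner ℝ (p j - p i) (v j) := by
    rw [Finset.sum_comm]
    exact Finset.sum_congr rfl fun i _ => Finset.sum_congr rfl fun j _ => by ring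
  have h2 : ∑ i, ∑ j, w i * w j * inner ℝ (p i - p j) (v i) +
      ∑ i, ∑ j, w i * w j * inner ℝ (p j - p i) (v j) ≤ 0 := by
    simp only [← Finset.sum_add_distrib]
    refine Finset.sum_nonpos fun i _ => Finset.sum_nonpos fun j _ => ?_
    have : w i * w j * inner ℝ (p i - p j) (v i) + w i * w j * inner ℝ (p j - p i) (v j) =
        w i * w j * inner ℝ (p i - p j) (v i - v j) := by
      rw [inner_sub_right, ← neg_sub (p i) (p j), inner_neg_left]
      ring
    rw [this]
    exact mul_nonpos_of_nonneg_of_nonpos (mul_nonneg (hw i) (hw j)) (h i j)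
  linarith

variable [Nonempty ι]

theorem continuous_softWills (q : ℝ) (p : ι → E) : Continuous (softWills q p) :=
  (continuous_expSumPow _).comp (continuous_gaussExponent q p)

theorem continuous_softWeight (q : ℝ) (p : ι → E) (i : ι) :
    Continuous fun x => softWeight q p x i :=
  (continuous_gibbs i).comp (continuous_gaussExponent q p)

theorem softWills_le {q m : ℝ} (hq : 0 < q) (p : ι → E) (x : E) (hm : 0 ≤ m)
    (h : ∀ i, Real.exp (-(π * ‖x - p i‖ ^ 2)) ≤ m) :
    softWills q p x ≤ (Fintype.card ι : ℝ) ^ q⁻¹ * m := by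
  have h1 : ∑ i, Real.exp (gaussExponent q p x i) ≤ (Fintype.card ι : ℝ) * m ^ q := by
    rw [← nsmul_eq_mul, Fintype.card]
    refine Finset.sum_le_card_nsmul _ _ _ fun i _ => ?_
    calc Real.exp (gaussExponent q p x i) = Real.exp (-(π * ‖x - p i‖ ^ 2)) ^ q := by
          rw [← Real.exp_mul, gaussExponent]; ring_nf
      _ ≤ m ^ q := Real.rpow_le_rpow (Real.exp_pos _).le (h i) hq.le
  calc softWills q p x ≤ ((Fintype.card ι : ℝ) * m ^ q) ^ q⁻¹ :=
        Real.rpow_le_rpow (sum_exp_pos _).le h1 (inv_nonneg.2 hq.le)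
    _ = _ := by
        rw [Real.mul_rpow (by positivity) (by positivity), ← Real.rpow_mul hm,
          mul_inv_cancel₀ hq.ne', Real.rpow_one]

/-- A Gaussian majorant of `softWills`, uniform over centres of norm at most `R`. -/
theorem one_add_norm_mul_softWills_le {q R : ℝ} (hq : 0 < q) {p : ι → E} (hR : ∀ i, ‖p i‖ ≤ R)
    (x : E) :
    (1 + ‖x‖) * softWills q p x ≤
      2 * (Fintype.card ι : ℝ) ^ q⁻¹ * Real.exp (π * R ^ 2) *
        Real.exp (-(π / 4) * ‖x‖ ^ 2) := by
  have hx : 1 + ‖x‖ ≤ 2 * Real.exp (π / 4 * ‖x‖ ^ 2) := by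
    have := Real.add_one_le_exp (π / 4 * ‖x‖ ^ 2)
    nlinarith [Real.pi_gt_three, sq_nonneg (‖x‖ - 1), sq_nonneg ‖x‖]
  have hs : softWills q p x ≤ (Fintype.card ι : ℝ) ^ q⁻¹ *
      (Real.exp (π * R ^ 2) * Real.exp (-(π / 2) * ‖x‖ ^ 2)) := by
    refine softWills_le hq p x (by positivity) fun i => ?_
    rw [← Real.exp_add, Real.exp_le_exp]
    have h1 : ‖x‖ ≤ ‖x - p i‖ + R := by
      have := norm_add_le (x - p i) (p i)
      rw [sub_add_cancel] at this
      linarith [hR i]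
    have h2 : ‖x‖ ^ 2 ≤ 2 * ‖x - p i‖ ^ 2 + 2 * R ^ 2 := by
      nlinarith [sq_nonneg (‖x - p i‖ - R), norm_nonneg x]
    nlinarith [Real.pi_pos]
  calc (1 + ‖x‖) * softWills q p x
      ≤ 2 * Real.exp (π / 4 * ‖x‖ ^ 2) * ((Fintype.card ι : ℝ) ^ q⁻¹ *
        (Real.exp (π * R ^ 2) * Real.exp (-(π / 2) * ‖x‖ ^ 2))) :=
        mul_le_mul hx hs (softWills_nonneg _ _ _) (by positivity)
    _ = 2 * (Fintype.card ι : ℝ) ^ q⁻¹ * Real.exp (π * R ^ 2) *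
        (Real.exp (π / 4 * ‖x‖ ^ 2) * Real.exp (-(π / 2) * ‖x‖ ^ 2)) := by ring
    _ = _ := by
        rw [← Real.exp_add]
        ring_nf

end Gaussian

section Interpolation

variable {E : Type*} [NormedAddCommGroup E] [InnerProductSpace ℝ E] [FiniteDimensional ℝ E]
  [MeasurableSpace E] [BorelSpace E] {ι : Type*} [Fintype ι] [Nonempty ι]

theorem integrable_exp_neg_mul_sq_norm {b : ℝ} (hb : 0 < b) :
    Integrable fun x : E => Real.exp (-b * ‖x‖ ^ 2) := by
  have h := (GaussianFourier.integrable_cexp_neg_mul_sq_norm_add (V := E) (b := (b : ℂ))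
    (by simpa using hb) 0 0).norm
  refine h.congr (Filter.Eventually.of_forall fun x => ?_)
  simp only [inner_zero_left, Complex.ofReal_zero, mul_zero, add_zero]
  rw [Complex.norm_exp]
  norm_cast

theorem integrable_of_abs_le_softWills {q C : ℝ} (hq : 0 < q) (p : ι → E) {f : E → ℝ}
    (hf : Continuous f) (hC : 0 ≤ C) (h : ∀ x, |f x| ≤ C * ((1 + ‖x‖) * softWills q p x)) :
    Integrable f := by
  have hR : ∀ i, ‖p i‖ ≤ ∑ j, ‖p j‖ := fun i =>
    Finset.single_le_sum (f := fun j => ‖p j‖) (fun _ _ => norm_nonneg _) (Finset.mem_univ i)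
  refine (((integrable_exp_neg_mul_sq_norm (E := E) (b := π / 4) (by positivity)).const_mul
    (2 * (Fintype.card ι : ℝ) ^ q⁻¹ * Real.exp (π * (∑ j, ‖p j‖) ^ 2))).const_mul C).mono'
    hf.aestronglyMeasurable (Filter.Eventually.of_forall fun x => (h x).trans ?_)
  exact mul_le_mul_of_nonneg_left (one_add_norm_mul_softWills_le hq hR x) hC

theorem integrable_softWills {q : ℝ} (hq : 0 < q) (p : ι → E) : Integrable (softWills q p) := by
  refine integrable_of_abs_le_softWills hq p (continuous_softWills q p) zero_le_one fun x => ?_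
  rw [abs_of_nonneg (softWills_nonneg _ _ _)]
  nlinarith [softWills_nonneg q p x, norm_nonneg x, mul_nonneg (norm_nonneg x)
    (softWills_nonneg q p x)]

theorem integrable_softWills_mul_inner {q : ℝ} (hq : 0 < q) (p : ι → E) {w : E → ℝ}
    (hw : Continuous w) (hw' : ∀ x, |w x| ≤ 1) (a v : E) :
    Integrable fun x => softWills q p x * (w x * inner ℝ (x - a) v) := by
  refine integrable_of_abs_le_softWills (C := (1 + ‖a‖) * ‖v‖) hq p
    ((continuous_softWills q p).mul (by fun_prop)) (by positivity) fun x => ?_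
  rw [abs_mul, abs_mul, abs_of_nonneg (softWills_nonneg _ _ _)]
  have h1 : |inner ℝ (x - a) v| ≤ ((1 + ‖a‖) * (1 + ‖x‖)) * ‖v‖ :=
    (abs_real_inner_le_norm _ _).trans (mul_le_mul_of_nonneg_right
      ((norm_sub_le _ _).trans (by nlinarith [norm_nonneg x, norm_nonneg a])) (norm_nonneg _))
  calc softWills q p x * (|w x| * |inner ℝ (x - a) v|)
      ≤ softWills q p x * (1 * (((1 + ‖a‖) * (1 + ‖x‖)) * ‖v‖)) :=
        mul_le_mul_of_nonneg_left (mul_le_mul (hw' x) h1 (abs_nonneg _) zero_le_one)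
          (softWills_nonneg _ _ _)
    _ = _ := by ring

theorem integrable_softWills_mul_softWeight_mul_inner {q : ℝ} (hq : 0 < q) (p : ι → E) (i : ι)
    (a v : E) : Integrable fun x => softWills q p x * (softWeight q p x i * inner ℝ (x - a) v) :=
  integrable_softWills_mul_inner hq p (continuous_softWeight q p i)
    (fun x => abs_softWeight_le_one q p x i) a v

theorem integrable_softWills_mul_softWeight_mul_softWeight_mul_inner {q : ℝ} (hq : 0 < q)
    (p : ι → E) (i j : ι) (a v : E) :
    Integrable fun x => softWills q p x *
      (softWeight q p x i * softWeight q p x j * inner ℝ (x - a) v) :=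
  integrable_softWills_mul_inner hq p
    ((continuous_softWeight q p i).mul (continuous_softWeight q p j))
    (fun x => by
      rw [Pi.mul_apply, abs_mul]
      exact mul_le_one₀ (abs_softWeight_le_one q p x i) (abs_nonneg _)
        (abs_softWeight_le_one q p x j)) a v

/-- The divergence theorem for `softWills q p * softWeight q p i` in the direction `v`. -/
theorem integral_softWills_mul_softWeight_mul_inner {q : ℝ} (hq : 0 < q) (p : ι → E) (i : ι)
    (v : E) :
    ∫ x, softWills q p x * (softWeight q p x i * inner ℝ (x - p i) v) =
      (1 - q⁻¹) * ∑ j, ∫ x, softWills q p x *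
        (softWeight q p x i * softWeight q p x j * inner ℝ (x - p j) v) := by
  set f : E → ℝ := fun x => softWills q p x * softWeight q p x i
  set f' : E → ℝ := fun x => -(2 * q * π) *
    (softWills q p x * (softWeight q p x i * inner ℝ (x - p i) v) - (1 - q⁻¹) *
      ∑ j, softWills q p x * (softWeight q p x i * softWeight q p x j * inner ℝ (x - p j) v))
  have hint1 := integrable_softWills_mul_softWeight_mul_inner hq p i (p i) v
  have hint2 : ∀ j ∈ Finset.univ, Integrable fun x => softWills q p x *
      (softWeight q p x i * softWeight q p x j * inner ℝ (x - p j) v) := fun j _ =>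
    integrable_softWills_mul_softWeight_mul_softWeight_mul_inner hq p i j (p j) v
  have hint3 := (integrable_finsetSum _ hint2).const_mul (1 - q⁻¹)
  have hf' : Integrable f' := (hint1.sub hint3).const_mul _
  have hf : Integrable f := by
    refine (integrable_softWills hq p).mono'
      ((continuous_softWills q p).mul (continuous_softWeight q p i)).aestronglyMeasurable
      (Filter.Eventually.of_forall fun x => ?_)
    rw [Real.norm_eq_abs, abs_mul, abs_of_nonneg (softWills_nonneg _ _ _)]
    exact mul_le_of_le_one_right (softWills_nonneg _ _ _) (abs_softWeight_le_one q p x i)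
  have hd : ∀ x, HasLineDerivAt ℝ f (f' x) x v := fun x => by
    have hx : HasDerivAt (fun t : ℝ => x + t • v) v 0 := by
      simpa using ((hasDerivAt_id (0 : ℝ)).smul_const v).const_add x
    have := hasDerivAt_expSumPow_mul_gibbs q⁻¹ (fun j => hasDerivAt_gaussExponent q
      (hasDerivAt_const (0 : ℝ) (p j)) hx) i
    refine HasDerivAt.congr_deriv this ?_
    simp only [zero_smul, add_zero, zero_sub, inner_neg_right, f', softWills, softWeight,
      Finset.mul_sum, mul_sub]
    congr 1
    · ring
    · exact Finset.sum_congr rfl fun j _ => by ring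
  have key := integral_bilinear_hasLineDerivAt_right_eq_neg_left_of_integrable
    (μ := (volume : Measure E)) (f := f) (f' := f')
    (g := fun _ => (1 : ℝ)) (g' := fun _ => 0) (v := v) (B := ContinuousLinearMap.mul ℝ ℝ)
    (by simpa using hf') (by simp) (by simpa using hf) (fun x _ => hd x)
    (fun x _ => hasDerivAt_const _ _)
  have h0 : ∫ x, f' x = 0 := by simpa using key
  simp only [f'] at h0
  rw [integral_const_mul, integral_sub hint1 hint3, integral_const_mul,
    integral_finsetSum _ hint2] at h0
  rcases mul_eq_zero.1 h0 with h | h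
  · exact absurd h (by simp [hq.ne', Real.pi_ne_zero])
  · exact sub_eq_zero.1 h

theorem sum_integral_softWills_mul_softWeight_mul_inner_nonpos {q : ℝ} (hq : 1 ≤ q)
    {p v : ι → E} (h : ∀ i j, inner ℝ (p i - p j) (v i - v j) ≤ 0) :
    ∑ i, ∫ x, softWills q p x * (softWeight q p x i * inner ℝ (x - p i) (v i)) ≤ 0 := by
  have hq0 : 0 < q := one_pos.trans_le hq
  set X := ∑ i, ∫ x, softWills q p x * (softWeight q p x i * inner ℝ (x - p i) (v i)) with hX
  set Y := ∑ i, ∑ j, ∫ x, softWills q p x *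
    (softWeight q p x i * softWeight q p x j * inner ℝ (x - p j) (v i)) with hY
  have hXY : X = (1 - q⁻¹) * Y := by
    rw [hX, hY, Finset.mul_sum]
    exact Finset.sum_congr rfl fun i _ => integral_softWills_mul_softWeight_mul_inner hq0 p i _
  have hle : Y ≤ X := by
    have hi := fun i (_ : i ∈ Finset.univ) =>
      integrable_softWills_mul_softWeight_mul_inner hq0 p i (p i) (v i)
    have hij := fun i j (_ : j ∈ Finset.univ) =>
      integrable_softWills_mul_softWeight_mul_softWeight_mul_inner hq0 p i j (p j) (v i)
    rw [hX, hY, ← integral_finsetSum _ hi,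
      Finset.sum_congr rfl fun i _ => (integral_finsetSum _ (hij i)).symm,
      ← integral_finsetSum _ fun i _ => integrable_finsetSum _ (hij i)]
    refine integral_mono
      (integrable_finsetSum _ fun i _ => integrable_finsetSum _ (hij i))
      (integrable_finsetSum _ hi) fun x => ?_
    have hpt := sum_sum_mul_inner_nonpos
      (fun i => gibbs_nonneg (gaussExponent q p x) i) h
    have hsum : ∑ j, softWeight q p x j = 1 := sum_gibbs _
    have hdiff : ∑ i, softWeight q p x i * inner ℝ (x - p i) (v i) =
        ∑ i, ∑ j, softWeight q p x i * softWeight q p x j * inner ℝ (x - p j) (v i) -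
        ∑ i, ∑ j, softWeight q p x i * softWeight q p x j * inner ℝ (p i - p j) (v i) := by
      simp only [← Finset.sum_sub_distrib]
      refine Finset.sum_congr rfl fun i _ => ?_
      rw [← one_mul (softWeight q p x i * _), ← hsum, Finset.sum_mul]
      refine Finset.sum_congr rfl fun j _ => ?_
      rw [← mul_sub, ← inner_sub_left, show x - p j - (p i - p j) = x - p i by abel]
      ring
    simp only [← Finset.mul_sum]
    refine mul_le_mul_of_nonneg_left ?_ (softWills_nonneg q p x)
    rw [hdiff]
    exact le_sub_self_iff _ |>.2 hpt
  have : q⁻¹ ≤ 1 := inv_le_one_of_one_le₀ hq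
  have : 0 < q⁻¹ := inv_pos.2 hq0
  nlinarith

end Interpolation

section Rotation

variable {E : Type*} [NormedAddCommGroup E] [InnerProductSpace ℝ E] {ι : Type*}

/-- The rotation path from `u` at time `0` to `v` at time `π / 2`. -/
def rotationPath (u v : ι → E) (t : ℝ) (i : ι) : E := Real.cos t • u i + Real.sin t • v i

/-- The velocity of `rotationPath`. -/
def rotationVelocity (u v : ι → E) (t : ℝ) (i : ι) : E := -Real.sin t • u i + Real.cos t • v i

theorem hasDerivAt_rotationPath (u v : ι → E) (t : ℝ) (i : ι) :
    HasDerivAt (fun s => rotationPath u v s i) (rotationVelocity u v t i) t :=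
  ((Real.hasDerivAt_cos t).smul_const (u i)).add ((Real.hasDerivAt_sin t).smul_const (v i))

theorem inner_rotationPath_sub_nonpos {u v : ι → E} (horth : ∀ i j, inner ℝ (u i) (v j) = 0)
    (hle : ∀ i j, ‖v i - v j‖ ≤ ‖u i - u j‖) {t : ℝ} (hs : 0 ≤ Real.sin t) (hc : 0 ≤ Real.cos t)
    (i j : ι) :
    inner ℝ (rotationPath u v t i - rotationPath u v t j)
      (rotationVelocity u v t i - rotationVelocity u v t j) ≤ 0 := by
  have h1 : rotationPath u v t i - rotationPath u v t j =
      Real.cos t • (u i - u j) + Real.sin t • (v i - v j) := by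
    simp only [rotationPath]; module
  have h2 : rotationVelocity u v t i - rotationVelocity u v t j =
      -Real.sin t • (u i - u j) + Real.cos t • (v i - v j) := by
    simp only [rotationVelocity]; module
  have ho : inner ℝ (u i - u j) (v i - v j) = 0 := by
    simp [inner_sub_left, inner_sub_right, horth]
  have ho' : inner ℝ (v i - v j) (u i - u j) = 0 := by rw [real_inner_comm, ho]
  have hsq : ‖v i - v j‖ ^ 2 ≤ ‖u i - u j‖ ^ 2 := pow_le_pow_left₀ (norm_nonneg _) (hle i j) 2
  rw [h1, h2]
  simp only [inner_add_left, inner_add_right, real_inner_smul_left, real_inner_smul_right, ho, ho',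
    real_inner_self_eq_norm_sq]
  nlinarith [mul_nonneg hs hc]

variable [Fintype ι]

theorem norm_smul_add_smul_le (u v : ι → E) {c s : ℝ} (hc : |c| ≤ 1) (hs : |s| ≤ 1) (i : ι) :
    ‖c • u i + s • v i‖ ≤ ∑ j, (‖u j‖ + ‖v j‖) := by
  refine (norm_add_le _ _).trans (le_trans ?_ (Finset.single_le_sum
    (f := fun j => ‖u j‖ + ‖v j‖) (fun _ _ => by positivity) (Finset.mem_univ i)))
  rw [norm_smul, norm_smul, Real.norm_eq_abs, Real.norm_eq_abs]
  exact add_le_add (mul_le_of_le_one_left (norm_nonneg _) hc)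
    (mul_le_of_le_one_left (norm_nonneg _) hs)

theorem norm_rotationPath_le (u v : ι → E) (t : ℝ) (i : ι) :
    ‖rotationPath u v t i‖ ≤ ∑ j, (‖u j‖ + ‖v j‖) :=
  norm_smul_add_smul_le u v (Real.abs_cos_le_one t) (Real.abs_sin_le_one t) i

theorem norm_rotationVelocity_le (u v : ι → E) (t : ℝ) (i : ι) :
    ‖rotationVelocity u v t i‖ ≤ ∑ j, (‖u j‖ + ‖v j‖) :=
  norm_smul_add_smul_le u v (by rw [abs_neg]; exact Real.abs_sin_le_one t)
    (Real.abs_cos_le_one t) i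

variable [Nonempty ι]

theorem hasDerivAt_softWills_rotationPath {q : ℝ} (hq : q ≠ 0) (u v : ι → E) (x : E) (t : ℝ) :
    HasDerivAt (fun s => softWills q (rotationPath u v s) x)
      (2 * π * ∑ i, softWills q (rotationPath u v t) x *
        (softWeight q (rotationPath u v t) x i *
          inner ℝ (x - rotationPath u v t i) (rotationVelocity u v t i))) t := by
  have := hasDerivAt_expSumPow q⁻¹ (fun i => hasDerivAt_gaussExponent q
    (hasDerivAt_rotationPath u v t i) (hasDerivAt_const t x))
  refine HasDerivAt.congr_deriv this ?_
  simp only [sub_zero, softWills, softWeight, Finset.mul_sum]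
  refine Finset.sum_congr rfl fun i _ => ?_
  field_simp

variable [FiniteDimensional ℝ E] [MeasurableSpace E] [BorelSpace E]

theorem hasDerivAt_integral_softWills_rotationPath {q : ℝ} (hq : 0 < q) (u v : ι → E) (t : ℝ) :
    HasDerivAt (fun s => ∫ x, softWills q (rotationPath u v s) x)
      (2 * π * ∑ i, ∫ x, softWills q (rotationPath u v t) x *
        (softWeight q (rotationPath u v t) x i *
          inner ℝ (x - rotationPath u v t i) (rotationVelocity u v t i))) t := by
  set R := ∑ j, (‖u j‖ + ‖v j‖) with hR
  have hR0 : 0 ≤ R := Finset.sum_nonneg fun _ _ => by positivity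
  have hint := fun i (_ : i ∈ Finset.univ) => integrable_softWills_mul_softWeight_mul_inner hq
    (rotationPath u v t) i (rotationPath u v t i) (rotationVelocity u v t i)
  rw [← integral_finsetSum _ hint, ← integral_const_mul]
  refine (hasDerivAt_integral_of_dominated_loc_of_deriv_le
    (bound := fun x => (2 * π * ∑ _i : ι, (1 + R) * R) * (2 * (Fintype.card ι : ℝ) ^ q⁻¹ *
      Real.exp (π * R ^ 2) * Real.exp (-(π / 4) * ‖x‖ ^ 2)))
    Filter.univ_mem
    (Filter.Eventually.of_forall fun s => (continuous_softWills q _).aestronglyMeasurable)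
    (integrable_softWills hq _)
    ((integrable_finsetSum _ hint).const_mul (2 * π)).aestronglyMeasurable
    (Filter.Eventually.of_forall fun x s _ => ?_)
    (((integrable_exp_neg_mul_sq_norm (by positivity)).const_mul _).const_mul _)
    (Filter.Eventually.of_forall fun x s _ =>
      hasDerivAt_softWills_rotationPath hq.ne' u v x s)).2
  refine le_trans ?_ (mul_le_mul_of_nonneg_left (one_add_norm_mul_softWills_le hq
    (norm_rotationPath_le u v s) x) (by positivity))
  rw [Real.norm_eq_abs, abs_mul, abs_of_pos Real.two_pi_pos, mul_assoc (2 * π), Finset.sum_mul]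
  refine mul_le_mul_of_nonneg_left ((Finset.abs_sum_le_sum_abs _ _).trans
    (Finset.sum_le_sum fun i _ => ?_)) Real.two_pi_pos.le
  rw [abs_mul, abs_mul, abs_of_nonneg (softWills_nonneg _ _ _)]
  have h1 : |inner ℝ (x - rotationPath u v s i) (rotationVelocity u v s i)| ≤
      ((1 + R) * (1 + ‖x‖)) * R := by
    refine (abs_real_inner_le_norm _ _).trans (mul_le_mul ((norm_sub_le _ _).trans ?_)
      (norm_rotationVelocity_le u v s i) (norm_nonneg _) (by positivity))
    nlinarith [norm_nonneg x, norm_rotationPath_le u v s i, mul_nonneg hR0 (norm_nonneg x)]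
  calc softWills q (rotationPath u v s) x * (|softWeight q (rotationPath u v s) x i| *
        |inner ℝ (x - rotationPath u v s i) (rotationVelocity u v s i)|)
      ≤ softWills q (rotationPath u v s) x * (1 * (((1 + R) * (1 + ‖x‖)) * R)) :=
        mul_le_mul_of_nonneg_left (mul_le_mul (abs_softWeight_le_one _ _ _ _) h1 (abs_nonneg _)
          zero_le_one) (softWills_nonneg _ _ _)
    _ = _ := by ring

theorem integral_softWills_le {q : ℝ} (hq : 1 ≤ q) {u v : ι → E}
    (horth : ∀ i j, inner ℝ (u i) (v j) = 0) (hle : ∀ i j, ‖v i - v j‖ ≤ ‖u i - u j‖) :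
    ∫ x, softWills q v x ≤ ∫ x, softWills q u x := by
  have hd := hasDerivAt_integral_softWills_rotationPath (one_pos.trans_le hq) u v
  have hpi : (0 : ℝ) ≤ π / 2 := by positivity
  have hanti : AntitoneOn (fun s => ∫ x, softWills q (rotationPath u v s) x)
      (Set.Icc 0 (π / 2)) := by
    refine antitoneOn_of_deriv_nonpos (convex_Icc _ _)
      (fun t _ => (hd t).continuousAt.continuousWithinAt)
      (fun t _ => (hd t).differentiableAt.differentiableWithinAt) fun t ht => ?_
    rw [interior_Icc] at ht
    rw [(hd t).deriv]
    refine mul_nonpos_of_nonneg_of_nonpos Real.two_pi_pos.le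
      (sum_integral_softWills_mul_softWeight_mul_inner_nonpos hq
        (inner_rotationPath_sub_nonpos horth hle
          (Real.sin_nonneg_of_nonneg_of_le_pi ht.1.le (by linarith [ht.2]))
          (Real.cos_nonneg_of_neg_pi_div_two_le_of_le (by linarith [ht.1]) ht.2.le)))
  have h := hanti (Set.left_mem_Icc.2 hpi) (Set.right_mem_Icc.2 hpi) hpi
  have h0 : rotationPath u v 0 = u := by ext i; simp [rotationPath]
  have h1 : rotationPath u v (π / 2) = v := by ext i; simp [rotationPath]
  simpa only [h0, h1] using h

end Rotation

section Comparison

variable {E : Type*} [NormedAddCommGroup E]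

/-- The Gaussian `exp (-(π * ‖x - a‖ ^ 2))` with centre `a`, as an extended nonnegative real. -/
def gaussAt (a x : E) : ℝ≥0∞ := ENNReal.ofReal (Real.exp (-(π * ‖x - a‖ ^ 2)))

theorem continuous_gaussAt (a : E) : Continuous (gaussAt a) :=
  ENNReal.continuous_ofReal.comp (by fun_prop)

theorem gaussAt_toLp {F : Type*} [NormedAddCommGroup F] (a x : E) (b y : F) :
    gaussAt (WithLp.toLp 2 (a, b)) (WithLp.toLp 2 (x, y)) = gaussAt a x * gaussAt b y := by
  rw [gaussAt, gaussAt, gaussAt, ← ENNReal.ofReal_mul (Real.exp_pos _).le, ← Real.exp_add,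
    ← WithLp.toLp_sub, WithLp.prod_norm_sq_eq_of_L2]
  congr 2
  change -(π * (‖x - a‖ ^ 2 + ‖y - b‖ ^ 2)) = _
  ring

variable [MeasurableSpace E] [BorelSpace E]

theorem measurable_iSup_gaussAt {ι : Type*} [Countable ι] (u : ι → E) :
    Measurable fun x => ⨆ i, gaussAt (u i) x :=
  Measurable.iSup fun i => (continuous_gaussAt (u i)).measurable

variable [InnerProductSpace ℝ E] [FiniteDimensional ℝ E]

theorem lintegral_gaussAt_zero : ∫⁻ x : E, gaussAt 0 x = 1 := by
  have hint := integrable_exp_neg_mul_sq_norm (E := E) Real.pi_pos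
  have h := GaussianFourier.integral_rexp_neg_mul_sq_norm (V := E) Real.pi_pos
  rw [div_self Real.pi_ne_zero, Real.one_rpow] at h
  have h2 := ofReal_integral_eq_lintegral_ofReal hint
    (Filter.Eventually.of_forall fun x => (Real.exp_pos _).le)
  rw [h, ENNReal.ofReal_one] at h2
  simpa [gaussAt] using h2.symm

variable {ι : Type*} [Fintype ι]

theorem lintegral_iSup_gaussAt_le_of_inner_eq_zero [Nonempty ι] {u v : ι → E}
    (horth : ∀ i j, inner ℝ (u i) (v j) = 0) (hle : ∀ i j, ‖v i - v j‖ ≤ ‖u i - u j‖) :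
    ∫⁻ x, ⨆ i, gaussAt (v i) x ≤ ∫⁻ x, ⨆ i, gaussAt (u i) x := by
  have key : ∀ n : ℕ, ∫⁻ x, ⨆ i, gaussAt (v i) x ≤
      ENNReal.ofReal ((Fintype.card ι : ℝ) ^ ((n : ℝ) + 1)⁻¹) *
        ∫⁻ x, ⨆ i, gaussAt (u i) x := fun n => by
    have hq : (1 : ℝ) ≤ (n : ℝ) + 1 := by simp
    have hq0 : (0 : ℝ) < (n : ℝ) + 1 := by positivity
    calc ∫⁻ x, ⨆ i, gaussAt (v i) x
        ≤ ∫⁻ x, ENNReal.ofReal (softWills ((n : ℝ) + 1) v x) :=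
          lintegral_mono fun x => iSup_le fun i =>
            ENNReal.ofReal_le_ofReal (exp_le_softWills hq0 v x i)
      _ = ENNReal.ofReal (∫ x, softWills ((n : ℝ) + 1) v x) :=
          (ofReal_integral_eq_lintegral_ofReal (integrable_softWills hq0 v)
            (Filter.Eventually.of_forall fun x => softWills_nonneg _ _ x)).symm
      _ ≤ ENNReal.ofReal (∫ x, softWills ((n : ℝ) + 1) u x) :=
          ENNReal.ofReal_le_ofReal (integral_softWills_le hq horth hle)
      _ = ∫⁻ x, ENNReal.ofReal (softWills ((n : ℝ) + 1) u x) :=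
          ofReal_integral_eq_lintegral_ofReal (integrable_softWills hq0 u)
            (Filter.Eventually.of_forall fun x => softWills_nonneg _ _ x)
      _ ≤ ∫⁻ x, ENNReal.ofReal ((Fintype.card ι : ℝ) ^ ((n : ℝ) + 1)⁻¹) *
            ⨆ i, gaussAt (u i) x := lintegral_mono fun x => by
          obtain ⟨k, hk⟩ := Finite.exists_max fun i => Real.exp (-(π * ‖x - u i‖ ^ 2))
          refine (ENNReal.ofReal_le_ofReal
            (softWills_le hq0 u x (Real.exp_pos _).le hk)).trans ?_
          rw [ENNReal.ofReal_mul (by positivity)]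
          exact mul_le_mul_right (le_iSup (fun i => gaussAt (u i) x) k) _
      _ = _ := lintegral_const_mul _ (measurable_iSup_gaussAt u)
  have hlim : Filter.Tendsto (fun n : ℕ => ENNReal.ofReal
      ((Fintype.card ι : ℝ) ^ ((n : ℝ) + 1)⁻¹)) Filter.atTop (nhds 1) := by
    rw [← ENNReal.ofReal_one, ← Real.rpow_zero (Fintype.card ι : ℝ)]
    refine ENNReal.tendsto_ofReal (Filter.Tendsto.rpow tendsto_const_nhds ?_ (Or.inl ?_))
    · simpa using tendsto_one_div_add_atTop_nhds_zero_nat (𝕜 := ℝ)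
    · simp
  have h2 := ENNReal.Tendsto.mul_const (b := ∫⁻ x, ⨆ i, gaussAt (u i) x) hlim
    (Or.inl one_ne_zero)
  rw [one_mul] at h2
  exact ge_of_tendsto' h2 key

variable {F : Type*} [NormedAddCommGroup F] [InnerProductSpace ℝ F] [FiniteDimensional ℝ F]
  [MeasurableSpace F] [BorelSpace F]

theorem lintegral_iSup_gaussAt_toLp_left (a : ι → E) :
    ∫⁻ z : WithLp 2 (E × F), ⨆ i, gaussAt (WithLp.toLp 2 (a i, 0)) z =
      ∫⁻ x, ⨆ i, gaussAt (a i) x := by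
  rw [← (WithLp.volume_preserving_toLp E F).lintegral_comp (measurable_iSup_gaussAt _)]
  calc _ = ∫⁻ z : E × F, (⨆ i, gaussAt (a i) z.1) * gaussAt 0 z.2 :=
        lintegral_congr fun z => by
          rw [ENNReal.iSup_mul]
          exact iSup_congr fun i => gaussAt_toLp _ _ _ _
    _ = _ := by
        rw [Measure.volume_eq_prod, lintegral_prod_mul (measurable_iSup_gaussAt a).aemeasurable
          (continuous_gaussAt 0).measurable.aemeasurable, lintegral_gaussAt_zero, mul_one]

theorem lintegral_iSup_gaussAt_toLp_right (b : ι → F) :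
    ∫⁻ z : WithLp 2 (E × F), ⨆ i, gaussAt (WithLp.toLp 2 (0, b i)) z =
      ∫⁻ x, ⨆ i, gaussAt (b i) x := by
  rw [← (WithLp.volume_preserving_toLp E F).lintegral_comp (measurable_iSup_gaussAt _)]
  calc _ = ∫⁻ z : E × F, gaussAt 0 z.1 * ⨆ i, gaussAt (b i) z.2 :=
        lintegral_congr fun z => by
          rw [ENNReal.mul_iSup]
          exact iSup_congr fun i => gaussAt_toLp _ _ _ _
    _ = _ := by
        rw [Measure.volume_eq_prod, lintegral_prod_mul
          (continuous_gaussAt 0).measurable.aemeasurable (measurable_iSup_gaussAt b).aemeasurable,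
          lintegral_gaussAt_zero, one_mul]

theorem lintegral_iSup_gaussAt_le [Nonempty ι] {a : ι → E} {b : ι → F}
    (hle : ∀ i j, ‖b i - b j‖ ≤ ‖a i - a j‖) :
    ∫⁻ y, ⨆ i, gaussAt (b i) y ≤ ∫⁻ x, ⨆ i, gaussAt (a i) x := by
  rw [← lintegral_iSup_gaussAt_toLp_left (F := F) a,
    ← lintegral_iSup_gaussAt_toLp_right (E := E) b]
  refine lintegral_iSup_gaussAt_le_of_inner_eq_zero (fun i j => by simp) fun i j => ?_
  rw [← WithLp.toLp_sub, ← WithLp.toLp_sub, Prod.mk_sub_mk, Prod.mk_sub_mk, sub_zero, sub_zero,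
    WithLp.norm_toLp_fst, WithLp.norm_toLp_snd]
  exact hle i j

end Comparison

theorem gaussAt_le_ofReal_exp_infDist {E : Type*} [NormedAddCommGroup E] {A : Set E} {a : E}
    (ha : a ∈ A) (x : E) :
    gaussAt a x ≤ ENNReal.ofReal (Real.exp (-π * (Metric.infDist x A) ^ 2)) := by
  refine ENNReal.ofReal_le_ofReal (Real.exp_le_exp.2 ?_)
  have h := pow_le_pow_left₀ Metric.infDist_nonneg (Metric.infDist_le_dist_of_mem ha (x := x)) 2
  rw [dist_eq_norm] at h
  nlinarith [Real.pi_pos]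

theorem ofReal_exp_infDist_le_iSup_gaussAt {E ι : Type*} [NormedAddCommGroup E] {B : Set E}
    {b : ι → B} (hb : DenseRange b) (hB : B.Nonempty) (x : E) :
    ENNReal.ofReal (Real.exp (-π * (Metric.infDist x B) ^ 2)) ≤ ⨆ i, gaussAt (b i : E) x := by
  have hpt : ∀ y ∈ B, gaussAt y x ≤ ⨆ i, gaussAt (b i : E) x := fun y hy => by
    have hcont : Continuous fun z : B => gaussAt (z : E) x :=
      ENNReal.continuous_ofReal.comp (by fun_prop)
    exact hb.induction_on (p := fun z : B => gaussAt (z : E) x ≤ ⨆ i, gaussAt (b i : E) x)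
      ⟨y, hy⟩ (isClosed_le hcont continuous_const) fun i => le_iSup (fun i => gaussAt (b i : E) x) i
  have hcont : Continuous fun r : ℝ => ENNReal.ofReal (Real.exp (-π * r ^ 2)) :=
    ENNReal.continuous_ofReal.comp (by fun_prop)
  have hlim : Filter.Tendsto (fun n : ℕ => Metric.infDist x B + 1 / ((n : ℝ) + 1)) Filter.atTop
      (nhds (Metric.infDist x B)) := by
    simpa using tendsto_const_nhds.add (tendsto_one_div_add_atTop_nhds_zero_nat (𝕜 := ℝ))
  refine le_of_tendsto' ((hcont.tendsto _).comp hlim) fun n => ?_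
  obtain ⟨y, hy, hlt⟩ := (Metric.infDist_lt_iff hB).1
    (lt_add_of_pos_right (Metric.infDist x B) (Nat.one_div_pos_of_nat (α := ℝ) (n := n)))
  refine le_trans (ENNReal.ofReal_le_ofReal (Real.exp_le_exp.2 ?_)) (hpt y hy)
  have h := pow_le_pow_left₀ dist_nonneg hlt.le 2
  rw [dist_eq_norm] at h
  nlinarith [Real.pi_pos]

/-- Comparison inequality for the Wills functional: if `φ` maps `A` onto `B` and is a
contraction (`‖φθ - φθ'‖ ≤ ‖θ - θ'‖` on `A`), then `W(B) ≤ W(A)`. -/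
theorem wills_comparison (m n : ℕ)
    (A : Set (EuclideanSpace ℝ (Fin m))) (B : Set (EuclideanSpace ℝ (Fin n)))
    (hA : A.Nonempty) (hB : B.Nonempty)
    (φ : EuclideanSpace ℝ (Fin m) → EuclideanSpace ℝ (Fin n))
    (hsurj : φ '' A = B)
    (hcontr : ∀ θ ∈ A, ∀ θ' ∈ A, ‖φ θ - φ θ'‖ ≤ ‖θ - θ'‖) :
    wills n B ≤ wills m A := by
  have : Nonempty B := hB.to_subtype
  set b : ℕ → B := TopologicalSpace.denseSeq B
  choose a haA hab using fun k => hsurj.ge (b k).2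
  calc wills n B
      ≤ ∫⁻ x, ⨆ N : ℕ, ⨆ k : Fin (N + 1), gaussAt (b k : EuclideanSpace ℝ (Fin n)) x := by
        refine lintegral_mono fun x => (ofReal_exp_infDist_le_iSup_gaussAt
          (TopologicalSpace.denseRange_denseSeq B) hB x).trans (iSup_le fun k => ?_)
        exact le_iSup_of_le k (le_iSup_of_le (Fin.last k) (by simp [b]))
    _ = ⨆ N : ℕ, ∫⁻ x, ⨆ k : Fin (N + 1), gaussAt (b k : EuclideanSpace ℝ (Fin n)) x := by
        refine lintegral_iSup (fun N => measurable_iSup_gaussAt _) fun N M hNM x => ?_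
        exact iSup_le fun k => le_iSup_of_le (Fin.castLE (by omega) k) (by simp)
    _ ≤ wills m A := iSup_le fun N => by
        refine (lintegral_iSup_gaussAt_le (a := fun k : Fin (N + 1) => a k) fun i j => ?_).trans
          (lintegral_mono fun x => iSup_le fun k => gaussAt_le_ofReal_exp_infDist (haA k) x)
        rw [← hab, ← hab]
        exact hcontr _ (haA _) _ (haA _)
end
end

section
/- (Characterization of the minimax redundancy.) For every nonempty set A ⊆ ℝⁿ, one has r̃(A)²/300 ≤ mred(A) ≤ 2·r̃(A)², and also (1/600)·inf_{r>0} { log N(A,r) + r² } ≤ mred(A) ≤ inf_{r>0} { log N(A,r) + r² }, with all quantities possibly equal to +∞. -/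
open MeasureTheory ENNReal Real Set

noncomputable section

/-- The Gaussian measure `N(θ, I_n)` on `ℝⁿ`, with density
`(2π)^{-n/2} exp(-‖y-θ‖²/2)` with respect to Lebesgue measure. -/
def gaussMeasure (n : ℕ) (θ : EuclideanSpace ℝ (Fin n)) : Measure (EuclideanSpace ℝ (Fin n)) :=
  volume.withDensity fun y =>
    ENNReal.ofReal ((2 * π) ^ (-(n : ℝ) / 2) * Real.exp (-‖y - θ‖ ^ 2 / 2))

open Classical in
/-- The Kullback–Leibler divergence `KL(P ‖ Q) = ∫ log(dP/dQ) dP` when `P ≪ Q` and the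
integral is well defined, and `+∞` otherwise. -/
def klDiv {α : Type*} [MeasurableSpace α] (P Q : Measure α) : ℝ≥0∞ :=
  if P ≪ Q ∧ Integrable (fun x => Real.log (P.rnDeriv Q x).toReal) P
  then ENNReal.ofReal (∫ x, Real.log (P.rnDeriv Q x).toReal ∂P)
  else ⊤

/-- The minimax redundancy `mred(A) = inf_Q sup_{θ ∈ A} KL(N(θ,I_n) ‖ Q)`, the infimum
running over all probability measures `Q` on `ℝⁿ`. -/
def mred (n : ℕ) (A : Set (EuclideanSpace ℝ (Fin n))) : ℝ≥0∞ :=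
  ⨅ (Q : Measure (EuclideanSpace ℝ (Fin n))) (_ : IsProbabilityMeasure Q),
    ⨆ θ ∈ A, klDiv (gaussMeasure n θ) Q

/-- The covering number `N(A, r)`: the least number of closed balls of radius `r` with
centers in `A` needed to cover `A` (`∞` if no finite cover exists). -/
def coveringNumber (n : ℕ) (A : Set (EuclideanSpace ℝ (Fin n))) (r : ℝ) : ℝ≥0∞ :=
  sInf {N : ℝ≥0∞ | ∃ s : Finset (EuclideanSpace ℝ (Fin n)),
    ↑s ⊆ A ∧ (s.card : ℝ≥0∞) = N ∧ A ⊆ ⋃ θ ∈ s, Metric.closedBall θ r}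

/-- `log N(A, r)`, valued in `[0, ∞]` (note `N(A,r) ≥ 1` for nonempty `A`). -/
def logCov (n : ℕ) (A : Set (EuclideanSpace ℝ (Fin n))) (r : ℝ) : ℝ≥0∞ :=
  if coveringNumber n A r = ⊤ then ⊤
  else ENNReal.ofReal (Real.log (coveringNumber n A r).toReal)

/-- The fixed point `r̃(A) = sup{r ≥ 0 : log N(A,r) ≥ r²}`, valued in `[0, ∞]`. -/
def rTilde (n : ℕ) (A : Set (EuclideanSpace ℝ (Fin n))) : ℝ≥0∞ :=
  sSup {x : ℝ≥0∞ | ∃ r : ℝ, 0 ≤ r ∧ x = ENNReal.ofReal r ∧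
    ENNReal.ofReal (r ^ 2) ≤ logCov n A r}

section Gaussian

variable {n : ℕ}

/-- The density of `N(θ, I_n)` with respect to Lebesgue measure. -/
def gaussDensity (n : ℕ) (θ y : EuclideanSpace ℝ (Fin n)) : ℝ :=
  (2 * π) ^ (-(n : ℝ) / 2) * Real.exp (-‖y - θ‖ ^ 2 / 2)

lemma gaussDensity_pos (θ y : EuclideanSpace ℝ (Fin n)) : 0 < gaussDensity n θ y := by
  unfold gaussDensity; positivity

lemma continuous_gaussDensity (θ : EuclideanSpace ℝ (Fin n)) : Continuous (gaussDensity n θ) := by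
  unfold gaussDensity; fun_prop

lemma gaussMeasure_eq (θ : EuclideanSpace ℝ (Fin n)) :
    gaussMeasure n θ = volume.withDensity fun y => ENNReal.ofReal (gaussDensity n θ y) := rfl

lemma integral_gaussDensity (θ : EuclideanSpace ℝ (Fin n)) : ∫ y, gaussDensity n θ y = 1 := by
  have h := GaussianFourier.integral_rexp_neg_mul_sq_norm
    (V := EuclideanSpace ℝ (Fin n)) (b := 1 / 2) (by norm_num)
  unfold gaussDensity
  rw [integral_const_mul,
    integral_sub_right_eq_self (fun y : EuclideanSpace ℝ (Fin n) => Real.exp (-‖y‖ ^ 2 / 2)) θ]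
  have h2 : ∀ y : EuclideanSpace ℝ (Fin n), -‖y‖ ^ 2 / 2 = -(1 / 2) * ‖y‖ ^ 2 := fun y => by ring
  simp_rw [h2]
  rw [h, finrank_euclideanSpace_fin, show π / (1 / 2) = 2 * π by ring, ← Real.rpow_add (by positivity)]
  rw [show -(n : ℝ) / 2 + n / 2 = 0 by ring, Real.rpow_zero]

lemma integrable_gaussDensity (θ : EuclideanSpace ℝ (Fin n)) :
    Integrable (gaussDensity n θ) volume := by
  by_contra h
  simpa [integral_undef h] using integral_gaussDensity θ

lemma isProbabilityMeasure_withDensity_ofReal {α : Type*} [MeasurableSpace α] {μ : Measure α}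
    {f : α → ℝ} (hf : Integrable f μ) (h0 : ∀ x, 0 ≤ f x) (h1 : ∫ x, f x ∂μ = 1) :
    IsProbabilityMeasure (μ.withDensity fun x => ENNReal.ofReal (f x)) := by
  constructor
  rw [withDensity_apply _ MeasurableSet.univ, Measure.restrict_univ,
    ← ofReal_integral_eq_lintegral_ofReal hf (.of_forall h0), h1, ENNReal.ofReal_one]

instance isProbabilityMeasure_gaussMeasure (θ : EuclideanSpace ℝ (Fin n)) :
    IsProbabilityMeasure (gaussMeasure n θ) :=
  isProbabilityMeasure_withDensity_ofReal (integrable_gaussDensity θ)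
    (fun y => (gaussDensity_pos θ y).le) (integral_gaussDensity θ)

lemma integrable_gaussMeasure_iff (θ : EuclideanSpace ℝ (Fin n))
    {f : EuclideanSpace ℝ (Fin n) → ℝ} :
    Integrable f (gaussMeasure n θ) ↔ Integrable (fun y => gaussDensity n θ y * f y) volume := by
  rw [gaussMeasure_eq, integrable_withDensity_iff_integrable_smul'
    (continuous_gaussDensity θ).measurable.ennreal_ofReal (by simp)]
  simp [ENNReal.toReal_ofReal (gaussDensity_pos θ _).le]

lemma integral_gaussMeasure (θ : EuclideanSpace ℝ (Fin n))
    (f : EuclideanSpace ℝ (Fin n) → ℝ) :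
    ∫ y, f y ∂gaussMeasure n θ = ∫ y, gaussDensity n θ y * f y := by
  rw [gaussMeasure_eq, integral_withDensity_eq_integral_toReal_smul
    (continuous_gaussDensity θ).measurable.ennreal_ofReal (by simp)]
  simp [ENNReal.toReal_ofReal (gaussDensity_pos θ _).le]

/-- If the density of `N(θ, I)` times `f` is `a` times the density of `N(θ', I)`, then the
expectation of `f` under `N(θ, I)` is `a`. -/
lemma integral_gaussMeasure_of_mul_eq {θ θ' : EuclideanSpace ℝ (Fin n)} {a : ℝ}
    {f : EuclideanSpace ℝ (Fin n) → ℝ}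
    (h : ∀ y, gaussDensity n θ y * f y = a * gaussDensity n θ' y) :
    Integrable f (gaussMeasure n θ) ∧ ∫ y, f y ∂gaussMeasure n θ = a := by
  rw [integrable_gaussMeasure_iff, integral_gaussMeasure]
  simp_rw [h]
  exact ⟨(integrable_gaussDensity θ').const_mul a, by
    rw [integral_const_mul, integral_gaussDensity, mul_one]⟩

lemma sq_norm_sub_add_sq_norm_sub (θ₁ θ₂ y : EuclideanSpace ℝ (Fin n)) :
    ‖y - θ₁‖ ^ 2 + ‖y - θ₂‖ ^ 2
      = 2 * ‖y - (1 / 2 : ℝ) • (θ₁ + θ₂)‖ ^ 2 + ‖θ₁ - θ₂‖ ^ 2 / 2 := by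
  have h := parallelogram_law_with_norm ℝ (y - θ₁) (y - θ₂)
  have h1 : y - θ₁ + (y - θ₂) = (2 : ℝ) • (y - (1 / 2 : ℝ) • (θ₁ + θ₂)) := by
    rw [smul_sub, smul_smul, two_smul]; norm_num; abel
  have h2 : y - θ₁ - (y - θ₂) = -(θ₁ - θ₂) := by abel
  rw [h1, h2, norm_neg, norm_smul, Real.norm_two] at h
  nlinarith

/-- Hellinger affinity of two Gaussians. -/
lemma integral_exp_sub_gaussMeasure (θ₁ θ₂ : EuclideanSpace ℝ (Fin n)) :
    Integrable (fun y => Real.exp ((‖y - θ₁‖ ^ 2 - ‖y - θ₂‖ ^ 2) / 4)) (gaussMeasure n θ₁) ∧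
    ∫ y, Real.exp ((‖y - θ₁‖ ^ 2 - ‖y - θ₂‖ ^ 2) / 4) ∂gaussMeasure n θ₁
      = Real.exp (-‖θ₁ - θ₂‖ ^ 2 / 8) := by
  refine integral_gaussMeasure_of_mul_eq (θ' := (1 / 2 : ℝ) • (θ₁ + θ₂)) fun y => ?_
  have := sq_norm_sub_add_sq_norm_sub θ₁ θ₂ y
  unfold gaussDensity
  rw [mul_assoc, mul_left_comm (Real.exp (-‖θ₁ - θ₂‖ ^ 2 / 8)), ← Real.exp_add, ← Real.exp_add]
  congr 2
  linarith

/-- Expected likelihood ratio of two Gaussians. -/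
lemma integral_gaussDensity_div_gaussMeasure (θ₁ θ₂ : EuclideanSpace ℝ (Fin n)) :
    Integrable (fun y => gaussDensity n θ₁ y / gaussDensity n θ₂ y) (gaussMeasure n θ₁) ∧
    ∫ y, gaussDensity n θ₁ y / gaussDensity n θ₂ y ∂gaussMeasure n θ₁
      = Real.exp (‖θ₁ - θ₂‖ ^ 2) := by
  refine integral_gaussMeasure_of_mul_eq (θ' := (2 : ℝ) • θ₁ - θ₂) fun y => ?_
  have h := sq_norm_sub_add_sq_norm_sub ((2 : ℝ) • θ₁ - θ₂) θ₂ y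
  rw [sub_add_cancel, smul_smul, show (2 : ℝ) • θ₁ - θ₂ - θ₂ = (2 : ℝ) • (θ₁ - θ₂) by
    rw [smul_sub, two_smul ℝ θ₂]; abel, norm_smul] at h
  norm_num at h
  rw [mul_div_assoc', div_eq_iff (gaussDensity_pos θ₂ y).ne']
  unfold gaussDensity
  have hexp : Real.exp (-‖y - θ₁‖ ^ 2 / 2) * Real.exp (-‖y - θ₁‖ ^ 2 / 2)
      = Real.exp (‖θ₁ - θ₂‖ ^ 2) * Real.exp (-‖y - ((2 : ℝ) • θ₁ - θ₂)‖ ^ 2 / 2)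
        * Real.exp (-‖y - θ₂‖ ^ 2 / 2) := by
    rw [← Real.exp_add, ← Real.exp_add, ← Real.exp_add]
    congr 1
    linarith
  linear_combination ((2 * π) ^ (-(n : ℝ) / 2)) ^ 2 * hexp

end Gaussian

section Divergence

variable {α : Type*} [MeasurableSpace α] {P Q : Measure α} [IsProbabilityMeasure P]
  [IsProbabilityMeasure Q]

lemma log_le_div_sub_one_add_log {x c : ℝ} (hx : 0 < x) (hc : 0 < c) :
    Real.log x ≤ x / c - 1 + Real.log c := by
  have := Real.log_le_sub_one_of_pos (div_pos hx hc)
  rw [Real.log_div hx.ne' hc.ne'] at this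
  linarith

/-- A linearised Donsker–Varadhan lower bound for the relative entropy. -/
lemma le_integral_log_rnDeriv (hPQ : P ≪ Q)
    (hint : Integrable (fun x => Real.log (P.rnDeriv Q x).toReal) P)
    {s : α → ℝ} {c : ℝ} (hs : Measurable s) (hs0 : ∀ x, 0 < s x) (hc : 0 < c)
    (hsP : Integrable s P) (hsc : ∫ x, s x ∂P ≤ c) (hsQ : Integrable (fun x => (s x)⁻¹) Q) :
    1 - ∫ x, (s x)⁻¹ ∂Q - Real.log c ≤ ∫ x, Real.log (P.rnDeriv Q x).toReal ∂P := by
  set ρ : α → ℝ := fun x => (P.rnDeriv Q x).toReal with hρ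
  have hρm : Measurable ρ := (Measure.measurable_rnDeriv P Q).ennreal_toReal
  have hρpos : ∀ᵐ x ∂P, 0 < ρ x := by
    filter_upwards [Measure.rnDeriv_pos hPQ, hPQ.ae_le (Measure.rnDeriv_ne_top P Q)] with x h0 h1
    exact ENNReal.toReal_pos h0.ne' h1
  have hle : ∀ x, ρ x * (ρ x * s x)⁻¹ ≤ (s x)⁻¹ := fun x => by
    rcases eq_or_ne (ρ x) 0 with h | h
    · simp [h, (hs0 x).le]
    · rw [mul_inv, mul_inv_cancel_left₀ h]
  have hQi : Integrable (fun x => ρ x * (ρ x * s x)⁻¹) Q := by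
    refine hsQ.mono' (by fun_prop) (.of_forall fun x => ?_)
    have : 0 ≤ ρ x := ENNReal.toReal_nonneg
    have := hs0 x
    rw [Real.norm_of_nonneg (by positivity)]
    exact hle x
  have hPi : Integrable (fun x => (ρ x * s x)⁻¹) P :=
    (integrable_rnDeriv_smul_iff (E := ℝ) hPQ).1 hQi
  have hPe : ∫ x, (ρ x * s x)⁻¹ ∂P ≤ ∫ x, (s x)⁻¹ ∂Q := by
    rw [← integral_rnDeriv_smul hPQ]
    exact integral_mono hQi hsQ hle
  have key : ∫ x, ((1 - (ρ x * s x)⁻¹) - (s x / c - 1 + Real.log c)) ∂P ≤ ∫ x, Real.log (ρ x) ∂P := by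
    refine integral_mono_ae (by fun_prop) hint ?_
    filter_upwards [hρpos] with x hx
    have h1 := Real.one_sub_inv_le_log_of_pos (mul_pos hx (hs0 x))
    rw [Real.log_mul hx.ne' (hs0 x).ne'] at h1
    have h2 := log_le_div_sub_one_add_log (hs0 x) hc
    linarith
  rw [integral_sub (by fun_prop) (by fun_prop), integral_sub (by fun_prop) hPi,
    integral_add (by fun_prop) (by fun_prop), integral_sub (by fun_prop) (by fun_prop),
    integral_div] at key
  simp only [integral_const, probReal_univ, one_smul] at key
  have : (∫ x, s x ∂P) / c ≤ 1 := (div_le_one hc).2 hsc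
  linarith

/-- An upper bound for the relative entropy in terms of a dominating likelihood ratio. -/
lemma klDiv_withDensity_le {g h : α → ℝ} {N c : ℝ} (hg : Measurable g) (hg0 : ∀ x, 0 < g x)
    (hN : 0 < N) (hc : 0 < c) (hPQ : P = Q.withDensity fun x => ENNReal.ofReal (g x))
    (hgP : Integrable (fun x => (g x)⁻¹) P) (hgh : ∀ x, g x ≤ N * h x)
    (hhP : Integrable h P) (hhc : ∫ x, h x ∂P ≤ c) :
    klDiv P Q ≤ ENNReal.ofReal (Real.log N + Real.log c) := by
  have hac : P ≪ Q := hPQ ▸ withDensity_absolutelyContinuous _ _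
  have hrn : (fun x => Real.log (P.rnDeriv Q x).toReal) =ᵐ[P] fun x => Real.log (g x) := by
    have := Measure.rnDeriv_withDensity Q hg.ennreal_ofReal
    rw [← hPQ] at this
    filter_upwards [hac.ae_le this] with x hx
    rw [hx, ENNReal.toReal_ofReal (hg0 x).le]
  have hh0 : ∀ x, 0 < h x := fun x => pos_of_mul_pos_right ((hg0 x).trans_le (hgh x)) hN.le
  have hub : ∀ x, Real.log (g x) ≤ Real.log N + (h x / c - 1 + Real.log c) := fun x => by
    have h1 := Real.log_le_log (hg0 x) (hgh x)
    rw [Real.log_mul hN.ne' (hh0 x).ne'] at h1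
    linarith [log_le_div_sub_one_add_log (hh0 x) hc]
  have hubi : Integrable (fun x => Real.log N + (h x / c - 1 + Real.log c)) P := by fun_prop
  have hint : Integrable (fun x => Real.log (g x)) P :=
    integrable_of_le_of_le hg.log.aestronglyMeasurable
      (.of_forall fun x => Real.one_sub_inv_le_log_of_pos (hg0 x)) (.of_forall hub)
      (by fun_prop) hubi
  unfold klDiv
  rw [if_pos ⟨hac, hint.congr hrn.symm⟩, integral_congr_ae hrn]
  refine ENNReal.ofReal_le_ofReal ((integral_mono hint hubi hub).trans ?_)
  rw [integral_add (by fun_prop) (by fun_prop), integral_add (by fun_prop) (by fun_prop),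
    integral_sub (by fun_prop) (by fun_prop), integral_div]
  simp only [integral_const, probReal_univ, one_smul]
  have : (∫ x, h x ∂P) / c ≤ 1 := (div_le_one hc).2 hhc
  linarith

end Divergence

section Covering

variable {n : ℕ} {A : Set (EuclideanSpace ℝ (Fin n))} {r : ℝ}

lemma coveringNumber_le {s : Finset (EuclideanSpace ℝ (Fin n))} (hs : ↑s ⊆ A)
    (hA : A ⊆ ⋃ θ ∈ s, Metric.closedBall θ r) : coveringNumber n A r ≤ s.card :=
  sInf_le ⟨s, hs, rfl, hA⟩

lemma exists_card_eq_coveringNumber (h : coveringNumber n A r ≠ ⊤) :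
    ∃ s : Finset (EuclideanSpace ℝ (Fin n)), ↑s ⊆ A ∧ (s.card : ℝ≥0∞) = coveringNumber n A r ∧
      A ⊆ ⋃ θ ∈ s, Metric.closedBall θ r := by
  let S : Set ℕ := {k | ∃ s : Finset (EuclideanSpace ℝ (Fin n)),
    ↑s ⊆ A ∧ s.card = k ∧ A ⊆ ⋃ θ ∈ s, Metric.closedBall θ r}
  have hS : S.Nonempty := by
    by_contra hS
    refine h (sInf_eq_top.2 ?_)
    rintro _ ⟨s, hsA, -, hcov⟩
    exact (hS ⟨s.card, s, hsA, rfl, hcov⟩).elim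
  obtain ⟨s, hsA, hcard, hcov⟩ := Nat.sInf_mem hS
  refine ⟨s, hsA, le_antisymm (le_sInf ?_) (coveringNumber_le hsA hcov), hcov⟩
  rintro _ ⟨t, htA, rfl, htcov⟩
  rw [hcard]
  exact_mod_cast Nat.sInf_le (⟨t, htA, rfl, htcov⟩ : t.card ∈ S)

lemma one_le_coveringNumber (hA : A.Nonempty) : 1 ≤ coveringNumber n A r := by
  refine le_sInf ?_
  rintro _ ⟨s, -, rfl, hcov⟩
  obtain ⟨a, ha⟩ := hA
  obtain ⟨θ, hθ, -⟩ := mem_iUnion₂.1 (hcov ha)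
  exact_mod_cast Finset.card_pos.2 ⟨θ, hθ⟩

/-- Either `A` contains `k` points that are pairwise more than `r` apart, or fewer than `k` balls
of radius `r` cover `A`. -/
lemma exists_separated_or_coveringNumber_lt (A : Set (EuclideanSpace ℝ (Fin n))) (hr : 0 ≤ r)
    (k : ℕ) :
    (∃ s : Finset (EuclideanSpace ℝ (Fin n)), ↑s ⊆ A ∧ s.card = k ∧
      ∀ x ∈ s, ∀ y ∈ s, x ≠ y → r < dist x y) ∨ coveringNumber n A r < k := by
  classical
  induction k with
  | zero => exact .inl ⟨∅, by simp⟩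
  | succ k ih =>
    rcases ih with ⟨s, hsA, hcard, hsep⟩ | h
    · by_cases hcov : A ⊆ ⋃ θ ∈ s, Metric.closedBall θ r
      · right
        refine (coveringNumber_le hsA hcov).trans_lt ?_
        rw [hcard]
        exact_mod_cast k.lt_succ_self
      · left
        obtain ⟨a, haA, ha⟩ := not_subset.1 hcov
        simp only [mem_iUnion, Metric.mem_closedBall, not_exists, not_le] at ha
        have has : a ∉ s := fun has => by simpa [hr.not_gt] using ha a has
        refine ⟨insert a s, ?_, by rw [Finset.card_insert_of_notMem has, hcard], ?_⟩
        · rw [Finset.coe_insert]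
          exact insert_subset haA hsA
        · intro x hx y hy hxy
          rcases Finset.mem_insert.1 hx with rfl | hx <;>
            rcases Finset.mem_insert.1 hy with rfl | hy
          · exact absurd rfl hxy
          · exact ha y hy
          · rw [dist_comm]; exact ha x ‹_›
          · exact hsep x hx y hy hxy
    · right
      exact h.trans (by exact_mod_cast k.lt_succ_self)

/-- If `log N(A, r) ≥ r²` then `A` contains at least `max(2, exp(r²))` points that are pairwise
more than `r` apart. -/
lemma exists_separated_of_le_logCov (hA : A.Nonempty) (hr : 0 < r)
    (h : ENNReal.ofReal (r ^ 2) ≤ logCov n A r) :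
    ∃ s : Finset (EuclideanSpace ℝ (Fin n)), ↑s ⊆ A ∧ (2 : ℝ) ≤ s.card ∧
      Real.exp (r ^ 2) ≤ s.card ∧ ∀ x ∈ s, ∀ y ∈ s, x ≠ y → r < dist x y := by
  have h1 : 1 < Real.exp (r ^ 2) := Real.one_lt_exp_iff.2 (by positivity)
  rcases exists_separated_or_coveringNumber_lt A hr.le ⌈Real.exp (r ^ 2)⌉₊ with
    ⟨s, hsA, hcard, hsep⟩ | hlt
  · refine ⟨s, hsA, ?_, hcard ▸ Nat.le_ceil _, hsep⟩
    have : 1 < ⌈Real.exp (r ^ 2)⌉₊ := Nat.lt_ceil.2 (by simpa using h1)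
    rw [hcard]
    exact_mod_cast this
  · exfalso
    have htop : coveringNumber n A r ≠ ⊤ := hlt.ne_top
    obtain ⟨s, -, hcard, -⟩ := exists_card_eq_coveringNumber htop
    rw [← hcard] at hlt
    have hlt' : (s.card : ℝ) < Real.exp (r ^ 2) := Nat.lt_ceil.1 (by exact_mod_cast hlt)
    have hpos : (0 : ℝ) < s.card := by
      have := one_le_coveringNumber (r := r) hA
      rw [← hcard] at this
      exact_mod_cast this
    rw [logCov, if_neg htop, ← hcard, ENNReal.toReal_natCast] at h
    have hlog : Real.log s.card < r ^ 2 := (Real.log_lt_iff_lt_exp hpos).2 hlt'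
    exact absurd h (not_le.2 ((ENNReal.ofReal_lt_ofReal_iff (by positivity)).2 hlog))

end Covering

section Bounds

variable {n : ℕ} {A : Set (EuclideanSpace ℝ (Fin n))} {r : ℝ}

lemma div_le_neg_log_affinity {M x : ℝ} (hM : 2 ≤ M) (hx : 0 ≤ x) (hMx : Real.exp x ≤ M) :
    x / 300 ≤ -Real.log (M⁻¹ * (1 + (M - 1) * Real.exp (-x / 8))) := by
  have hM0 : 0 < M := by linarith
  have hE1 : Real.exp (-x / 8) ≤ 1 := Real.exp_le_one_iff.2 (by linarith)
  have hE0 := Real.exp_pos (-x / 8)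
  have hpos : 0 < M⁻¹ * (1 + (M - 1) * Real.exp (-x / 8)) := by
    have : 0 ≤ (M - 1) * Real.exp (-x / 8) := mul_nonneg (by linarith) hE0.le
    positivity
  rw [le_neg, Real.log_le_iff_le_exp hpos]
  have heq : M⁻¹ * (1 + (M - 1) * Real.exp (-x / 8))
      = M⁻¹ * (1 - Real.exp (-x / 8)) + Real.exp (-x / 8) := by field_simp; ring
  rw [heq]
  rcases le_total x 142 with h | h
  · have h1 : M⁻¹ ≤ 1 / 2 := by rw [one_div]; exact inv_anti₀ (by norm_num) hM
    have h2 : Real.exp (-x / 8) ≤ 1 / (1 + x / 8) := by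
      rw [le_div_iff₀ (by positivity), ← le_div_iff₀' hE0, one_div, ← Real.exp_neg]
      linarith [Real.add_one_le_exp (-(-x / 8))]
    have h3 := Real.add_one_le_exp (-(x / 300))
    have h4 : M⁻¹ * (1 - Real.exp (-x / 8)) ≤ 1 / 2 * (1 - Real.exp (-x / 8)) := by
      gcongr
    have h5 : 1 / (1 + x / 8) ≤ 1 - x / 150 := by
      rw [div_le_iff₀ (by positivity)]
      nlinarith
    linarith
  · have h1 : M⁻¹ ≤ Real.exp (-x / 8) := by
      calc M⁻¹ ≤ (Real.exp x)⁻¹ := inv_anti₀ (Real.exp_pos x) hMx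
        _ = Real.exp (-x) := (Real.exp_neg x).symm
        _ ≤ Real.exp (-x / 8) := Real.exp_le_exp.2 (by linarith)
    have h2 : M⁻¹ * (1 - Real.exp (-x / 8)) ≤ M⁻¹ := by
      have := inv_pos.2 hM0
      nlinarith
    have h3 : Real.exp (-(x / 300)) = Real.exp (-x / 8) * Real.exp (x / 8 - x / 300) := by
      rw [← Real.exp_add]; congr 1; ring
    have h4 := Real.add_one_le_exp (x / 8 - x / 300)
    have h5 : 2 ≤ Real.exp (x / 8 - x / 300) := by linarith
    rw [h3]
    nlinarith

lemma sum_inv_gaussRatio {s : Finset (EuclideanSpace ℝ (Fin n))} (hs : s.Nonempty)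
    (y : EuclideanSpace ℝ (Fin n)) :
    ∑ i ∈ s, ((s.card : ℝ)⁻¹ * ∑ j ∈ s, Real.exp ((‖y - i‖ ^ 2 - ‖y - j‖ ^ 2) / 4))⁻¹
      = s.card := by
  have hW : 0 < ∑ j ∈ s, Real.exp (-‖y - j‖ ^ 2 / 4) :=
    Finset.sum_pos (fun _ _ => Real.exp_pos _) hs
  have h : ∀ i, ∑ j ∈ s, Real.exp ((‖y - i‖ ^ 2 - ‖y - j‖ ^ 2) / 4)
      = (Real.exp (-‖y - i‖ ^ 2 / 4))⁻¹ * ∑ j ∈ s, Real.exp (-‖y - j‖ ^ 2 / 4) := fun i => by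
    rw [Finset.mul_sum]
    refine Finset.sum_congr rfl fun j _ => ?_
    rw [← Real.exp_neg, ← Real.exp_add]
    congr 1
    ring
  simp_rw [h, mul_inv, inv_inv, ← mul_assoc]
  rw [← Finset.sum_mul, ← Finset.mul_sum, mul_assoc, mul_inv_cancel₀ hW.ne', mul_one]

/-- Lower bound on the largest relative entropy over a separated set of means. -/
lemma neg_log_affinity_le_iSup_klDiv {s : Finset (EuclideanSpace ℝ (Fin n))} (hs : s.Nonempty)
    (hr : 0 ≤ r) (hsep : ∀ x ∈ s, ∀ y ∈ s, x ≠ y → r < dist x y)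
    (Q : Measure (EuclideanSpace ℝ (Fin n))) [IsProbabilityMeasure Q] :
    ∃ θ ∈ s, ENNReal.ofReal
      (-Real.log ((s.card : ℝ)⁻¹ * (1 + (s.card - 1) * Real.exp (-r ^ 2 / 8))))
        ≤ klDiv (gaussMeasure n θ) Q := by
  set M : ℝ := (s.card : ℝ) with hM
  have hM1 : 1 ≤ M := Nat.one_le_cast.2 hs.card_pos
  set c : ℝ := M⁻¹ * (1 + (M - 1) * Real.exp (-r ^ 2 / 8)) with hcdef
  have hc : 0 < c := by
    have : 0 ≤ (M - 1) * Real.exp (-r ^ 2 / 8) := mul_nonneg (by linarith) (Real.exp_pos _).le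
    positivity
  by_contra! hlt
  let f : EuclideanSpace ℝ (Fin n) → EuclideanSpace ℝ (Fin n) → ℝ := fun i y =>
    M⁻¹ * ∑ j ∈ s, Real.exp ((‖y - i‖ ^ 2 - ‖y - j‖ ^ 2) / 4)
  have hfm : ∀ i, Measurable (f i) := fun i => by fun_prop
  have hf0 : ∀ i y, 0 < f i y := fun i y =>
    mul_pos (by positivity) (Finset.sum_pos (fun _ _ => Real.exp_pos _) hs)
  have hsum : ∀ y, ∑ i ∈ s, (f i y)⁻¹ = M := sum_inv_gaussRatio hs
  have hfQ : ∀ i ∈ s, Integrable (fun y => (f i y)⁻¹) Q := fun i hi => by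
    refine (integrable_const M).mono' (hfm i).inv.aestronglyMeasurable (.of_forall fun y => ?_)
    rw [Real.norm_of_nonneg (inv_pos.2 (hf0 i y)).le, ← hsum y]
    exact Finset.single_le_sum (f := fun i => (f i y)⁻¹)
      (fun j _ => (inv_pos.2 (hf0 j y)).le) hi
  have hfP : ∀ i, Integrable (f i) (gaussMeasure n i) := fun i =>
    (integrable_finsetSum _ fun j _ => (integral_exp_sub_gaussMeasure i j).1).const_mul _
  have hfc : ∀ i ∈ s, ∫ y, f i y ∂gaussMeasure n i ≤ c := fun i hi => by
    rw [integral_const_mul, integral_finsetSum _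
      fun j _ => (integral_exp_sub_gaussMeasure i j).1]
    simp_rw [(integral_exp_sub_gaussMeasure i _).2]
    rw [hcdef]
    gcongr
    classical
    rw [← Finset.add_sum_erase s _ hi]
    gcongr
    · simp
    · refine (Finset.sum_le_card_nsmul _ _ (Real.exp (-r ^ 2 / 8)) fun j hj => ?_).trans ?_
      · obtain ⟨hji, hj⟩ := Finset.mem_erase.1 hj
        have := hsep i hi j hj hji.symm
        rw [dist_eq_norm] at this
        gcongr
      · rw [nsmul_eq_mul, Finset.card_erase_of_mem hi, Nat.cast_pred hs.card_pos]
  have hkl : ∀ i ∈ s, 1 - ∫ y, (f i y)⁻¹ ∂Q - Real.log c < -Real.log c := fun i hi => by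
    have h := hlt i hi
    unfold klDiv at h
    split_ifs at h with hcond
    · refine (le_integral_log_rnDeriv hcond.1 hcond.2 (hfm i) (hf0 i) hc (hfP i) (hfc i hi)
        (hfQ i hi)).trans_lt ?_
      exact (ENNReal.ofReal_lt_ofReal_iff').1 h |>.1
    · exact absurd h not_top_lt
  have h1 := Finset.sum_lt_sum_of_nonempty hs hkl
  have h2 : ∑ i ∈ s, ∫ y, (f i y)⁻¹ ∂Q = M := by
    rw [← integral_finsetSum _ hfQ]
    simp [hsum]
  simp only [Finset.sum_sub_distrib, h2, Finset.sum_const, nsmul_eq_mul, ← hM] at h1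
  linarith

lemma ofReal_div_le_mred (hA : A.Nonempty) (hr : 0 ≤ r)
    (h : ENNReal.ofReal (r ^ 2) ≤ logCov n A r) :
    ENNReal.ofReal (r ^ 2 / 300) ≤ mred n A := by
  rcases hr.eq_or_lt with rfl | hr
  · simp
  obtain ⟨s, hsA, hs2, hsr, hsep⟩ := exists_separated_of_le_logCov hA hr h
  have hs : s.Nonempty := Finset.card_pos.1 (by exact_mod_cast zero_lt_two.trans_le hs2)
  refine le_iInf₂ fun Q hQ => ?_
  obtain ⟨θ, hθ, hle⟩ := neg_log_affinity_le_iSup_klDiv hs hr.le hsep Q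
  refine (ENNReal.ofReal_le_ofReal ?_).trans (hle.trans ?_)
  · exact div_le_neg_log_affinity hs2 (by positivity) hsr
  · exact le_iSup₂ (f := fun θ _ => klDiv (gaussMeasure n θ) Q) θ (hsA hθ)

/-- The relative entropy to a uniform mixture of Gaussians. -/
lemma klDiv_gaussMeasure_mixture_le {s : Finset (EuclideanSpace ℝ (Fin n))} (hs : s.Nonempty) :
    ∃ Q : Measure (EuclideanSpace ℝ (Fin n)), IsProbabilityMeasure Q ∧
      ∀ θ, ∀ θ' ∈ s, klDiv (gaussMeasure n θ) Q
        ≤ ENNReal.ofReal (Real.log s.card + ‖θ - θ'‖ ^ 2) := by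
  have hM : (0 : ℝ) < s.card := by exact_mod_cast hs.card_pos
  let q : EuclideanSpace ℝ (Fin n) → ℝ := fun y =>
    (s.card : ℝ)⁻¹ * ∑ i ∈ s, gaussDensity n i y
  have hq0 : ∀ y, 0 < q y := fun y =>
    mul_pos (by positivity) (Finset.sum_pos (fun _ _ => gaussDensity_pos _ _) hs)
  have hqm : Measurable q := by
    have : ∀ i, Measurable (gaussDensity n i) := fun i => (continuous_gaussDensity i).measurable
    fun_prop
  have hqi : Integrable q volume :=
    (integrable_finsetSum _ fun i _ => integrable_gaussDensity i).const_mul _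
  have hq1 : ∫ y, q y = 1 := by
    rw [integral_const_mul, integral_finsetSum _ fun i _ => integrable_gaussDensity i]
    simp [integral_gaussDensity, hM.ne']
  have hQ := isProbabilityMeasure_withDensity_ofReal hqi (fun y => (hq0 y).le) hq1
  refine ⟨_, hQ, fun θ θ' hθ' => ?_⟩
  have hp := gaussDensity_pos θ
  have hpm := (continuous_gaussDensity θ).measurable
  rw [← Real.log_exp (‖θ - θ'‖ ^ 2)]
  refine klDiv_withDensity_le (g := fun y => gaussDensity n θ y / q y)
    (h := fun y => gaussDensity n θ y / gaussDensity n θ' y) (hpm.div hqm)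
    (fun y => div_pos (hp y) (hq0 y)) hM (Real.exp_pos _) ?_ ?_ (fun y => ?_)
    (integral_gaussDensity_div_gaussMeasure θ θ').1
    (integral_gaussDensity_div_gaussMeasure θ θ').2.le
  · rw [← withDensity_mul _ hqm.ennreal_ofReal (by fun_prop), gaussMeasure_eq]
    congr 1
    funext y
    rw [Pi.mul_apply, ← ENNReal.ofReal_mul (hq0 y).le, mul_div_cancel₀ _ (hq0 y).ne']
  · rw [integrable_gaussMeasure_iff]
    simp_rw [inv_div, mul_div_cancel₀ _ (hp _).ne']
    exact hqi
  · rw [mul_div_assoc', div_le_div_iff₀ (hq0 y) (gaussDensity_pos θ' y), mul_comm (s.card : ℝ),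
      mul_assoc]
    refine mul_le_mul_of_nonneg_left ?_ (hp y).le
    rw [mul_inv_cancel_left₀ hM.ne']
    exact Finset.single_le_sum (fun i _ => (gaussDensity_pos i y).le) hθ'

lemma mred_le_logCov_add (hA : A.Nonempty) (r : ℝ) :
    mred n A ≤ logCov n A r + ENNReal.ofReal (r ^ 2) := by
  by_cases htop : coveringNumber n A r = ⊤
  · simp [logCov, htop]
  obtain ⟨s, -, hcard, hcov⟩ := exists_card_eq_coveringNumber htop
  have hs : s.Nonempty := by
    have := one_le_coveringNumber (r := r) hA
    rw [← hcard] at this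
    exact Finset.card_pos.1 (by exact_mod_cast this)
  obtain ⟨Q, hQ, hle⟩ := klDiv_gaussMeasure_mixture_le hs
  refine iInf₂_le_of_le Q hQ (iSup₂_le fun θ hθ => ?_)
  obtain ⟨θ', hθ', hd⟩ := mem_iUnion₂.1 (hcov hθ)
  rw [Metric.mem_closedBall, dist_eq_norm] at hd
  rw [logCov, if_neg htop, ← hcard, ENNReal.toReal_natCast,
    ← ENNReal.ofReal_add (Real.log_natCast_nonneg _) (by positivity)]
  exact (hle θ θ' hθ').trans (ENNReal.ofReal_le_ofReal (by gcongr))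

lemma rTilde_sq_div_le_mred (hA : A.Nonempty) : rTilde n A ^ 2 / 300 ≤ mred n A := by
  rw [ENNReal.div_le_iff (by norm_num) (by norm_num)]
  have h : rTilde n A ≤ (mred n A * 300) ^ (1 / 2 : ℝ) := by
    refine sSup_le ?_
    rintro _ ⟨r, hr, rfl, hle⟩
    rw [one_div, ENNReal.le_rpow_inv_iff (by norm_num), ← ENNReal.div_le_iff (by norm_num)
      (by norm_num)]
    refine le_trans (le_of_eq ?_) (ofReal_div_le_mred hA hr hle)
    rw [ENNReal.ofReal_div_of_pos (by norm_num), ENNReal.ofReal_pow hr, ENNReal.ofReal_ofNat,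
      ENNReal.rpow_two]
  rwa [one_div, ENNReal.le_rpow_inv_iff (by norm_num), ENNReal.rpow_two] at h

lemma iInf_logCov_add_le :
    ⨅ r ∈ Set.Ioi (0 : ℝ), (logCov n A r + ENNReal.ofReal (r ^ 2)) ≤ 2 * rTilde n A ^ 2 := by
  by_cases htop : rTilde n A = ⊤
  · simp [htop]
  lift rTilde n A to NNReal using htop with ρ hρ
  have hbound : ∀ r : ℝ, (ρ : ℝ) < r →
      ⨅ r ∈ Set.Ioi (0 : ℝ), (logCov n A r + ENNReal.ofReal (r ^ 2))
        ≤ ENNReal.ofReal (2 * r ^ 2) := fun r hr => by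
    have hr0 : 0 < r := ρ.coe_nonneg.trans_lt hr
    refine iInf₂_le_of_le r hr0 ?_
    have hlt : logCov n A r < ENNReal.ofReal (r ^ 2) := by
      by_contra! hge
      have : ENNReal.ofReal r ≤ rTilde n A := le_sSup ⟨r, hr0.le, rfl, hge⟩
      rw [← hρ, ← ENNReal.ofReal_coe_nnreal] at this
      exact absurd ((ENNReal.ofReal_le_ofReal_iff ρ.coe_nonneg).1 this) hr.not_ge
    rw [two_mul, ENNReal.ofReal_add (by positivity) (by positivity)]
    gcongr
  have hlim : Filter.Tendsto (fun r : ℝ => ENNReal.ofReal (2 * r ^ 2)) (nhdsWithin ρ (Ioi ρ))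
      (nhds (ENNReal.ofReal (2 * (ρ : ℝ) ^ 2))) :=
    ((ENNReal.continuous_ofReal.comp (by fun_prop : Continuous fun r : ℝ => 2 * r ^ 2)).tendsto
      _).mono_left nhdsWithin_le_nhds
  refine (ge_of_tendsto hlim (Filter.eventually_of_mem self_mem_nhdsWithin hbound)).trans_eq ?_
  rw [ENNReal.ofReal_mul zero_le_two, ENNReal.ofReal_pow ρ.coe_nonneg,
    ENNReal.ofReal_coe_nnreal, ENNReal.ofReal_ofNat]

end Bounds

/-- Characterization of the minimax redundancy:
`r̃(A)²/300 ≤ mred(A) ≤ 2·r̃(A)²` and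
`(1/600)·inf_{r>0} {log N(A,r) + r²} ≤ mred(A) ≤ inf_{r>0} {log N(A,r) + r²}`. -/
theorem minimax_redundancy_bounds (n : ℕ) (A : Set (EuclideanSpace ℝ (Fin n)))
    (hA : A.Nonempty) :
    (rTilde n A ^ 2 / 300 ≤ mred n A ∧ mred n A ≤ 2 * rTilde n A ^ 2) ∧
    ((1 / 600 : ℝ≥0∞) * (⨅ r ∈ Set.Ioi (0 : ℝ), (logCov n A r + ENNReal.ofReal (r ^ 2)))
        ≤ mred n A ∧
      mred n A ≤ ⨅ r ∈ Set.Ioi (0 : ℝ), (logCov n A r + ENNReal.ofReal (r ^ 2))) := by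
  have hupper : mred n A ≤ ⨅ r ∈ Set.Ioi (0 : ℝ), (logCov n A r + ENNReal.ofReal (r ^ 2)) :=
    le_iInf₂ fun r _ => mred_le_logCov_add hA r
  have hlower := rTilde_sq_div_le_mred hA
  refine ⟨⟨hlower, hupper.trans iInf_logCov_add_le⟩, le_trans ?_ hlower, hupper⟩
  rw [one_div, mul_comm, ← div_eq_mul_inv, ENNReal.div_le_iff (by norm_num) (by norm_num)]
  refine iInf_logCov_add_le.trans_eq ?_
  rw [show (600 : ℝ≥0∞) = 300 * 2 by norm_num, ← mul_assoc,
    ENNReal.div_mul_cancel (by norm_num) (by norm_num), mul_comm]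
end
end

section
/- (Concavity of the Wills functional, Prékopa–Leindler form.) For all nonempty sets A, B ⊆ ℝⁿ and every λ ∈ [0,1], one has W( λA + (1−λ)B ) ≥ W(A)^λ · W(B)^{1−λ}, where λA + (1−λ)B = { λa + (1−λ)b : a ∈ A, b ∈ B } is the Minkowski combination; equivalently, R*( λA + (1−λ)B ) ≥ λ·R*(A) + (1−λ)·R*(B) in the extended reals. -/
open MeasureTheory ENNReal Real Set
open scoped Pointwise

noncomputable section

/-- The minimax regret `R*(A) = log((2π)^{-n/2} ∫ exp(-dist(x,A)²/2) dx)`. -/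
def minimaxRegret (n : ℕ) (A : Set (EuclideanSpace ℝ (Fin n))) : EReal :=
  ENNReal.log (∫⁻ x, ENNReal.ofReal
    ((2 * π) ^ (-(n : ℝ) / 2) * Real.exp (-(Metric.infDist x A) ^ 2 / 2)))

/-- The Brunn–Minkowski inequality on the real line. -/
theorem volume_add_volume_le_volume_add {A B : Set ℝ} (hA : MeasurableSet A)
    (hB : MeasurableSet B) (hA' : A.Nonempty) (hB' : B.Nonempty) :
    volume A + volume B ≤ volume (A + B) := by
  have compact_case : ∀ K L : Set ℝ, IsCompact K → IsCompact L → K.Nonempty → L.Nonempty →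
      volume K + volume L ≤ volume (K + L) := by
    intro K L hK hL hK' hL'
    obtain ⟨a, ha, ha'⟩ := hK.exists_isGreatest hK'
    obtain ⟨b, hb, hb'⟩ := hL.exists_isLeast hL'
    have hd : AEDisjoint volume ((fun x ↦ x + b) '' K) ((fun x ↦ a + x) '' L) := by
      refine measure_mono_null (t := {a + b}) ?_ (by simp)
      rintro _ ⟨⟨x, hx, rfl⟩, ⟨y, hy, hxy⟩⟩
      have h₁ := ha' hx
      have h₂ := hb' hy
      simp only [mem_singleton_iff] at *
      linarith
    have hm : MeasurableSet ((fun x ↦ a + x) '' L) :=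
      (hL.image (by fun_prop)).measurableSet
    calc volume K + volume L
        = volume ((fun x ↦ x + b) '' K) + volume ((fun x ↦ a + x) '' L) := by
          simp [image_add_left, image_add_right]
      _ = volume ((fun x ↦ x + b) '' K ∪ (fun x ↦ a + x) '' L) :=
          (measure_union₀ hm.nullMeasurableSet hd).symm
      _ ≤ volume (K + L) := by
          refine measure_mono (union_subset ?_ ?_)
          · rintro _ ⟨x, hx, rfl⟩
            exact add_mem_add hx hb
          · rintro _ ⟨y, hy, rfl⟩
            exact add_mem_add ha hy
  obtain ⟨a, ha⟩ := hA'
  obtain ⟨b, hb⟩ := hB'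
  rw [hA.measure_eq_iSup_isCompact, hB.measure_eq_iSup_isCompact]
  simp only [iSup_and']
  refine ENNReal.biSup_add_biSup_le' ⟨∅, by simp⟩ ⟨∅, by simp⟩ ?_
  rintro K ⟨hKA, hK⟩ L ⟨hLB, hL⟩
  calc volume K + volume L ≤ volume (insert a K) + volume (insert b L) := by
        gcongr <;> exact subset_insert _ _
    _ ≤ volume (insert a K + insert b L) :=
        compact_case _ _ (hK.insert a) (hL.insert b) (insert_nonempty _ _) (insert_nonempty _ _)
    _ ≤ volume (A + B) := by
        gcongr
        · exact insert_subset ha hKA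
        · exact insert_subset hb hLB

theorem lintegral_eq_lintegral_meas_ofReal_lt {α : Type*} [MeasurableSpace α] (μ : Measure α)
    {f : α → ℝ≥0∞} (hf : Measurable f) (hf' : ∀ x, f x ≠ ∞) :
    ∫⁻ x, f x ∂μ = ∫⁻ t in Ioi (0 : ℝ), μ {x | ENNReal.ofReal t < f x} := by
  calc ∫⁻ x, f x ∂μ = ∫⁻ x, ENNReal.ofReal (f x).toReal ∂μ := by
        simp [ENNReal.ofReal_toReal (hf' _)]
    _ = ∫⁻ t in Ioi (0 : ℝ), μ {x | t < (f x).toReal} :=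
        lintegral_eq_lintegral_meas_lt μ (ae_of_all _ fun x ↦ ENNReal.toReal_nonneg)
          hf.ennreal_toReal.aemeasurable
    _ = _ := by
        refine setLIntegral_congr_fun measurableSet_Ioi fun t ht ↦ ?_
        simp only [ENNReal.ofReal_lt_iff_lt_toReal (le_of_lt ht) (hf' _)]

theorem ENNReal.rpow_mul_rpow_le_add {l m : ℝ} (hl : 0 < l) (hm : 0 < m) (hlm : l + m = 1)
    (x y : ℝ≥0∞) : x ^ l * y ^ m ≤ ENNReal.ofReal l * x + ENNReal.ofReal m * y := by
  have h := ENNReal.young_inequality (x ^ l) (y ^ m) (p := l⁻¹) (q := m⁻¹)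
    (Real.HolderConjugate.inv_inv hl hm hlm)
  rw [← ENNReal.rpow_mul, ← ENNReal.rpow_mul, mul_inv_cancel₀ hl.ne', mul_inv_cancel₀ hm.ne',
    ENNReal.rpow_one, ENNReal.rpow_one, ENNReal.ofReal_inv_of_pos hl,
    ENNReal.ofReal_inv_of_pos hm, div_eq_mul_inv, div_eq_mul_inv, inv_inv, inv_inv] at h
  rwa [mul_comm (ENNReal.ofReal l), mul_comm (ENNReal.ofReal m)]

/-- The Prékopa–Leindler inequality with weights `l` and `m`, as a property of a measure. -/
def PrekopaLeindler {E : Type*} [AddCommGroup E] [Module ℝ E] [MeasurableSpace E]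
    (μ : Measure E) (l m : ℝ) : Prop :=
  ∀ ⦃f g h : E → ℝ≥0∞⦄, Measurable f → Measurable g → Measurable h →
    (∀ x y, f x ^ l * g y ^ m ≤ h (l • x + m • y)) →
    (∫⁻ x, f x ∂μ) ^ l * (∫⁻ x, g x ∂μ) ^ m ≤ ∫⁻ x, h x ∂μ

theorem add_lintegral_le_of_iSup_eq_one {l m : ℝ} (hl : 0 < l) (hm : 0 < m) (hlm : l + m = 1)
    {f g h : ℝ → ℝ≥0∞} (hf : Measurable f) (hg : Measurable g) (hh : Measurable h)
    (hf' : ⨆ x, f x = 1) (hg' : ⨆ x, g x = 1)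
    (hfgh : ∀ x y, f x ^ l * g y ^ m ≤ h (l • x + m • y)) :
    ENNReal.ofReal l * (∫⁻ x, f x) + ENNReal.ofReal m * (∫⁻ x, g x) ≤ ∫⁻ x, h x := by
  have hf1 : ∀ x, f x ≤ 1 := fun x ↦ hf' ▸ le_iSup f x
  have hg1 : ∀ x, g x ≤ 1 := fun x ↦ hg' ▸ le_iSup g x
  have hne : ∀ {u : ℝ≥0∞}, u ≤ 1 → u ≠ ∞ := fun hu ↦ (hu.trans_lt ENNReal.one_lt_top).ne
  refine le_trans ?_ (lintegral_mono fun x ↦ min_le_left (h x) 1)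
  rw [lintegral_eq_lintegral_meas_ofReal_lt _ hf fun x ↦ hne (hf1 x),
    lintegral_eq_lintegral_meas_ofReal_lt _ hg fun x ↦ hne (hg1 x),
    lintegral_eq_lintegral_meas_ofReal_lt _ (hh.min measurable_const)
      fun x ↦ hne (min_le_right _ _),
    ← lintegral_const_mul' _ _ ENNReal.ofReal_ne_top,
    ← lintegral_const_mul' _ _ ENNReal.ofReal_ne_top]
  refine (le_lintegral_add _ _).trans (setLIntegral_mono' measurableSet_Ioi fun t ht ↦ ?_)
  rcases lt_or_ge t 1 with ht1 | ht1
  · have ht1' : ENNReal.ofReal t < 1 := by simpa using ht1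
    have hA : {x | ENNReal.ofReal t < f x}.Nonempty := by
      rwa [← hf', lt_iSup_iff] at ht1'
    have hB : {x | ENNReal.ofReal t < g x}.Nonempty := by
      rwa [← hg', lt_iSup_iff] at ht1'
    have hAm : MeasurableSet {x | ENNReal.ofReal t < f x} := measurableSet_lt measurable_const hf
    have hBm : MeasurableSet {x | ENNReal.ofReal t < g x} := measurableSet_lt measurable_const hg
    have hsmul : ∀ {c : ℝ}, 0 < c → ∀ s : Set ℝ,
        ENNReal.ofReal c * volume s = volume (c • s) := fun hc s ↦ by
      simp [Measure.addHaar_smul, abs_of_pos hc]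
    rw [hsmul hl, hsmul hm]
    refine (volume_add_volume_le_volume_add (hAm.const_smul_of_ne_zero hl.ne')
      (hBm.const_smul_of_ne_zero hm.ne') hA.smul_set hB.smul_set).trans (measure_mono ?_)
    rintro _ ⟨_, ⟨x, hx, rfl⟩, _, ⟨y, hy, rfl⟩, rfl⟩
    refine lt_min ((lt_of_lt_of_le ?_ (hfgh x y))) ht1'
    calc ENNReal.ofReal t = ENNReal.ofReal t ^ l * ENNReal.ofReal t ^ m := by
          rw [← ENNReal.rpow_add_of_nonneg _ _ hl.le hm.le, hlm, ENNReal.rpow_one]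
      _ < f x ^ l * g y ^ m :=
          ENNReal.mul_lt_mul (ENNReal.rpow_lt_rpow hx hl) (ENNReal.rpow_lt_rpow hy hm)
  · have hempty : ∀ {u : ℝ → ℝ≥0∞}, (∀ x, u x ≤ 1) → {x | ENNReal.ofReal t < u x} = ∅ := by
      intro u hu
      refine eq_empty_of_forall_notMem fun x hx ↦ ?_
      exact absurd (lt_of_lt_of_le hx (hu x)) (not_lt.2 (by simpa using ht1))
    simp [hempty hf1, hempty hg1]

theorem prekopaLeindler_real {l m : ℝ} (hl : 0 < l) (hm : 0 < m) (hlm : l + m = 1) :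
    PrekopaLeindler (volume : Measure ℝ) l m := by
  have bounded_case : ∀ f g h : ℝ → ℝ≥0∞, Measurable f → Measurable g → Measurable h →
      ⨆ x, f x ≠ ∞ → ⨆ x, g x ≠ ∞ → (∀ x y, f x ^ l * g y ^ m ≤ h (l • x + m • y)) →
      (∫⁻ x, f x) ^ l * (∫⁻ x, g x) ^ m ≤ ∫⁻ x, h x := by
    intro f g h hf hg hh ha hb hfgh
    rcases eq_or_ne (⨆ x, f x) 0 with ha0 | ha0
    · have : ∀ x, f x = 0 := by simpa using ha0
      simp [this, hl]
    rcases eq_or_ne (⨆ x, g x) 0 with hb0 | hb0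
    · have : ∀ x, g x = 0 := by simpa using hb0
      simp [this, hm]
    set a := ⨆ x, f x
    set b := ⨆ x, g x
    set d := a⁻¹ ^ l * b⁻¹ ^ m with hd
    have hd0 : d ≠ 0 := by
      refine mul_ne_zero ?_ ?_ <;> simp [ENNReal.rpow_eq_zero_iff, *, hl.not_gt, hm.not_gt]
    have hdt : d ≠ ∞ := by
      refine ENNReal.mul_ne_top ?_ ?_ <;> apply ENNReal.rpow_ne_top_of_nonneg <;>
        simp [*, hl.le, hm.le]
    have hscale : ∀ u v, (a⁻¹ * u) ^ l * (b⁻¹ * v) ^ m = d * (u ^ l * v ^ m) := fun u v ↦ by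
      rw [ENNReal.mul_rpow_of_nonneg _ _ hl.le, ENNReal.mul_rpow_of_nonneg _ _ hm.le, hd]
      ring
    have key := add_lintegral_le_of_iSup_eq_one hl hm hlm (f := fun x ↦ a⁻¹ * f x)
      (g := fun x ↦ b⁻¹ * g x) (h := fun x ↦ d * h x) (hf.const_mul _) (hg.const_mul _)
      (hh.const_mul _)
      (by rw [← ENNReal.mul_iSup]; exact ENNReal.inv_mul_cancel ha0 ha)
      (by rw [← ENNReal.mul_iSup]; exact ENNReal.inv_mul_cancel hb0 hb)
      (fun x y ↦ by rw [hscale]; gcongr; exact hfgh x y)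
    rw [lintegral_const_mul _ hf, lintegral_const_mul _ hg, lintegral_const_mul _ hh] at key
    have := (ENNReal.rpow_mul_rpow_le_add hl hm hlm _ _).trans key
    rw [hscale] at this
    exact (ENNReal.mul_le_mul_iff_right hd0 hdt).1 this
  intro f g h hf hg hh hfgh
  have trunc : ∀ u : ℝ → ℝ≥0∞, Measurable u → ∀ p : ℝ, 0 < p →
      (∫⁻ x, u x) ^ p = ⨆ k : ℕ, (∫⁻ x, min (u x) k) ^ p := by
    intro u hu p hp
    have hsup : ∀ x, u x = ⨆ k : ℕ, min (u x) k := fun x ↦ by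
      rw [← inf_iSup_eq, ENNReal.iSup_natCast, inf_top_eq]
    conv_lhs => rw [lintegral_congr hsup]
    rw [lintegral_iSup (fun k ↦ hu.min measurable_const)
      fun i j hij x ↦ min_le_min_left _ (by exact_mod_cast hij)]
    exact (ENNReal.orderIsoRpow p hp).map_iSup _
  have hbdd : ∀ (u : ℝ → ℝ≥0∞) (k : ℕ), ⨆ x, min (u x) (k : ℝ≥0∞) ≠ ∞ := fun u k ↦
    ((iSup_le fun x ↦ min_le_right _ _).trans_lt (ENNReal.natCast_lt_top k)).ne
  rw [trunc f hf l hl, trunc g hg m hm, ENNReal.iSup_mul]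
  refine iSup_le fun i ↦ ?_
  rw [ENNReal.mul_iSup]
  refine iSup_le fun j ↦ bounded_case _ _ h (hf.min measurable_const) (hg.min measurable_const) hh
    (hbdd f i) (hbdd g j) fun x y ↦ le_trans ?_ (hfgh x y)
  gcongr <;> exact min_le_left _ _

section Products

variable {E F : Type*} [AddCommGroup E] [Module ℝ E] [MeasurableSpace E]
  [AddCommGroup F] [Module ℝ F] [MeasurableSpace F] {μ : Measure E} {ν : Measure F} {l m : ℝ}

theorem PrekopaLeindler.prod [SFinite ν] (hμ : PrekopaLeindler μ l m)
    (hν : PrekopaLeindler ν l m) : PrekopaLeindler (μ.prod ν) l m := by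
  intro f g h hf hg hh hfgh
  rw [lintegral_prod _ hf.aemeasurable, lintegral_prod _ hg.aemeasurable,
    lintegral_prod _ hh.aemeasurable]
  refine hμ hf.lintegral_prod_right' hg.lintegral_prod_right' hh.lintegral_prod_right'
    fun s t ↦ ?_
  exact hν (hf.comp measurable_prodMk_left) (hg.comp measurable_prodMk_left)
    (hh.comp measurable_prodMk_left) fun x y ↦ hfgh (s, x) (t, y)

theorem PrekopaLeindler.of_measurePreserving (hμ : PrekopaLeindler μ l m) (e : E ≃ᵐ F)
    (he : MeasurePreserving e μ ν) (hlin : ∀ x y, e (l • x + m • y) = l • e x + m • e y) :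
    PrekopaLeindler ν l m := by
  intro f g h hf hg hh hfgh
  rw [← he.lintegral_comp hf, ← he.lintegral_comp hg, ← he.lintegral_comp hh]
  refine hμ (hf.comp e.measurable) (hg.comp e.measurable) (hh.comp e.measurable) fun x y ↦ ?_
  simpa only [Function.comp, hlin] using hfgh (e x) (e y)

end Products

theorem prekopaLeindler_pi {l m : ℝ} (hl : 0 < l) (hm : 0 < m) (hlm : l + m = 1) (n : ℕ) :
    PrekopaLeindler (volume : Measure (Fin n → ℝ)) l m := by
  induction n with
  | zero =>
    intro f g h _ _ _ hfgh
    simp only [Measure.volume_pi_eq_dirac default, lintegral_dirac]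
    simpa only [Subsingleton.elim (l • default + m • default) (default : Fin 0 → ℝ)]
      using hfgh default default
  | succ n ih =>
    refine ((prekopaLeindler_real hl hm hlm).prod ih).of_measurePreserving
      (MeasurableEquiv.piFinSuccAbove (fun _ : Fin (n + 1) ↦ ℝ) 0).symm
      (volume_preserving_piFinSuccAbove (fun _ : Fin (n + 1) ↦ ℝ) 0).symm fun x y ↦ ?_
    ext i
    refine Fin.cases ?_ (fun j ↦ ?_) i <;> simp [MeasurableEquiv.piFinSuccAbove]

/-- The Prékopa–Leindler inequality on Euclidean space. -/
theorem prekopaLeindler_euclideanSpace {l m : ℝ} (hl : 0 < l) (hm : 0 < m) (hlm : l + m = 1)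
    (n : ℕ) : PrekopaLeindler (volume : Measure (EuclideanSpace ℝ (Fin n))) l m :=
  (prekopaLeindler_pi hl hm hlm n).of_measurePreserving
    (MeasurableEquiv.toLp 2 (Fin n → ℝ))
    (EuclideanSpace.volume_preserving_symm_measurableEquiv_toLp (Fin n)).symm fun _ _ ↦ rfl

theorem infDist_smul_add_smul_le {E : Type*} [NormedAddCommGroup E] [NormedSpace ℝ E]
    {A B : Set E} (hA : A.Nonempty) (hB : B.Nonempty) {l m : ℝ} (hl : 0 < l) (hm : 0 < m)
    (x y : E) : Metric.infDist (l • x + m • y) (l • A + m • B) ≤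
      l * Metric.infDist x A + m * Metric.infDist y B := by
  refine le_of_forall_pos_le_add fun ε hε ↦ ?_
  obtain ⟨a, ha, hxa⟩ := (Metric.infDist_lt_iff hA).1
    (lt_add_of_pos_right (Metric.infDist x A) (show 0 < ε / (l + m) by positivity))
  obtain ⟨b, hb, hyb⟩ := (Metric.infDist_lt_iff hB).1
    (lt_add_of_pos_right (Metric.infDist y B) (show 0 < ε / (l + m) by positivity))
  calc Metric.infDist (l • x + m • y) (l • A + m • B)
      ≤ dist (l • x + m • y) (l • a + m • b) :=
        Metric.infDist_le_dist_of_mem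
          (add_mem_add (smul_mem_smul_set ha) (smul_mem_smul_set hb))
    _ ≤ dist (l • x) (l • a) + dist (m • y) (m • b) := dist_add_add_le _ _ _ _
    _ = l * dist x a + m * dist y b := by
        rw [dist_smul₀, dist_smul₀, Real.norm_of_nonneg hl.le, Real.norm_of_nonneg hm.le]
    _ ≤ l * (Metric.infDist x A + ε / (l + m)) + m * (Metric.infDist y B + ε / (l + m)) := by
        gcongr
    _ = l * Metric.infDist x A + m * Metric.infDist y B + ε := by
        field_simp
        ring

theorem lintegral_gaussian_infDist_rpow_mul_le (n : ℕ) {A B : Set (EuclideanSpace ℝ (Fin n))}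
    (hA : A.Nonempty) (hB : B.Nonempty) {l : ℝ} (hl0 : 0 ≤ l) (hl1 : l ≤ 1)
    {K c : ℝ} (hK : 0 < K) (hc : 0 ≤ c) :
    (∫⁻ x, ENNReal.ofReal (K * Real.exp (-c * Metric.infDist x A ^ 2))) ^ l *
      (∫⁻ x, ENNReal.ofReal (K * Real.exp (-c * Metric.infDist x B ^ 2))) ^ (1 - l) ≤
    ∫⁻ x, ENNReal.ofReal
      (K * Real.exp (-c * Metric.infDist x (l • A + (1 - l) • B) ^ 2)) := by
  rcases hl0.eq_or_lt with rfl | hl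
  · simp [zero_smul_set hA]
  rcases hl1.eq_or_lt with rfl | hl'
  · simp [zero_smul_set hB]
  have hm : 0 < 1 - l := sub_pos.2 hl'
  have hmeas : ∀ S : Set (EuclideanSpace ℝ (Fin n)), Measurable fun x ↦
      ENNReal.ofReal (K * Real.exp (-c * Metric.infDist x S ^ 2)) := fun S ↦ by
    have := (Metric.continuous_infDist_pt S).measurable
    fun_prop
  refine prekopaLeindler_euclideanSpace hl hm (by ring) n (hmeas A) (hmeas B) (hmeas _)
    fun x y ↦ ?_
  rw [ENNReal.ofReal_rpow_of_pos (by positivity), ENNReal.ofReal_rpow_of_pos (by positivity),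
    ← ENNReal.ofReal_mul (by positivity)]
  refine ENNReal.ofReal_le_ofReal ?_
  rw [Real.mul_rpow hK.le (Real.exp_nonneg _), Real.mul_rpow hK.le (Real.exp_nonneg _),
    mul_mul_mul_comm, ← Real.rpow_add hK, add_sub_cancel, Real.rpow_one, ← Real.exp_mul,
    ← Real.exp_mul, ← Real.exp_add]
  gcongr
  have h₁ := infDist_smul_add_smul_le hA hB hl hm x y
  have h₂ : Metric.infDist (l • x + (1 - l) • y) (l • A + (1 - l) • B) ^ 2 ≤
      (l * Metric.infDist x A + (1 - l) * Metric.infDist y B) ^ 2 :=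
    pow_le_pow_left₀ Metric.infDist_nonneg h₁ 2
  have h₃ : (l * Metric.infDist x A + (1 - l) * Metric.infDist y B) ^ 2 ≤
      l * Metric.infDist x A ^ 2 + (1 - l) * Metric.infDist y B ^ 2 := by
    nlinarith [mul_nonneg (mul_nonneg hl.le hm.le)
      (sq_nonneg (Metric.infDist x A - Metric.infDist y B))]
  nlinarith [mul_le_mul_of_nonneg_left (h₂.trans h₃) hc]

/-- Concavity of the Wills functional (Prékopa–Leindler form): for nonempty `A, B ⊆ ℝⁿ`
and `λ ∈ [0,1]`, `W(λA + (1-λ)B) ≥ W(A)^λ · W(B)^{1-λ}`; equivalently,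
`R*(λA + (1-λ)B) ≥ λ·R*(A) + (1-λ)·R*(B)` in the extended reals. -/
theorem wills_concavity (n : ℕ) (A B : Set (EuclideanSpace ℝ (Fin n)))
    (hA : A.Nonempty) (hB : B.Nonempty) (l : ℝ) (hl0 : 0 ≤ l) (hl1 : l ≤ 1) :
    wills n A ^ l * wills n B ^ (1 - l) ≤ wills n (l • A + (1 - l) • B) ∧
    (l : EReal) * minimaxRegret n A + ((1 - l : ℝ) : EReal) * minimaxRegret n B
      ≤ minimaxRegret n (l • A + (1 - l) • B) := by
  refine ⟨?_, ?_⟩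
  · simpa [wills] using lintegral_gaussian_infDist_rpow_mul_le n hA hB hl0 hl1 one_pos pi_pos.le
  · have h := lintegral_gaussian_infDist_rpow_mul_le n hA hB hl0 hl1 (c := 1 / 2)
      (show 0 < (2 * π) ^ (-(n : ℝ) / 2) by positivity) (by norm_num)
    have hexp : ∀ u : ℝ, -(1 / 2) * u ^ 2 = -u ^ 2 / 2 := fun u ↦ by ring
    simp only [hexp] at h
    simp only [minimaxRegret]
    rw [← ENNReal.log_rpow, ← ENNReal.log_rpow, ← ENNReal.log_mul_add]
    exact ENNReal.log_monotone h
end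
end

section
/- (Sub-additivity of the minimax regret under Minkowski sums.) For all nonempty sets A, B ⊆ ℝⁿ, one has W(A + B) ≤ W(A)·W(B), where A + B = { a + b : a ∈ A, b ∈ B } is the Minkowski sum; equivalently, R*(A + B) ≤ R*(A) + R*(B) in the extended reals. In particular, R*(A − A) ≤ 2·R*(A), where A − A = { a − a' : a, a' ∈ A }. -/
open MeasureTheory ENNReal Real Set
open scoped Pointwise

noncomputable section

section GaussianSum

variable {H : Type*} [NormedAddCommGroup H] {ι : Type*} [Fintype ι]

/-- The sum of the Gaussian weights `exp (-q ‖y i‖²)` of a finite family of vectors. -/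
def gaussianSum (q : ℝ) (y : ι → H) : ℝ := ∑ i, Real.exp (-q * ‖y i‖ ^ 2)

lemma gaussianSum_pos [Nonempty ι] (q : ℝ) (y : ι → H) : 0 < gaussianSum q y :=
  Finset.sum_pos (fun _ _ => Real.exp_pos _) Finset.univ_nonempty

lemma exp_le_gaussianSum (q : ℝ) (y : ι → H) (i : ι) :
    Real.exp (-q * ‖y i‖ ^ 2) ≤ gaussianSum q y :=
  Finset.single_le_sum (f := fun i => Real.exp (-q * ‖y i‖ ^ 2))
    (fun _ _ => (Real.exp_pos _).le) (Finset.mem_univ i)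

lemma continuous_gaussianSum {X : Type*} [TopologicalSpace X] (q : ℝ) {y : ι → X → H}
    (hy : ∀ i, Continuous (y i)) : Continuous fun x => gaussianSum q fun i => y i x := by
  unfold gaussianSum
  fun_prop

/-- The weight of the pair `(i, j)` in the derivative of `gaussianSum (p * κ) y ^ (1 / p)`. -/
def pairWeight (p κ : ℝ) (y : ι → H) (i j : ι) : ℝ :=
  gaussianSum (p * κ) y ^ (1 / p - 2) *
    (Real.exp (-(p * κ) * ‖y i‖ ^ 2) * Real.exp (-(p * κ) * ‖y j‖ ^ 2))

section

variable [InnerProductSpace ℝ H]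

lemma hasDerivAt_exp_neg_mul_norm_sq (q : ℝ) {y : ℝ → H} {y' : H} {t : ℝ}
    (hy : HasDerivAt y y' t) :
    HasDerivAt (fun s => Real.exp (-q * ‖y s‖ ^ 2))
      (Real.exp (-q * ‖y t‖ ^ 2) * (-(2 * q) * inner ℝ (y t) y')) t := by
  convert! ((hy.norm_sq.const_mul (-q)).exp) using 1
  ring

lemma hasDerivAt_gaussianSum (q : ℝ) {y : ι → ℝ → H} {y' : ι → H} {t : ℝ}
    (hy : ∀ i, HasDerivAt (y i) (y' i) t) :
    HasDerivAt (fun s => gaussianSum q fun i => y i s)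
      (∑ i, Real.exp (-q * ‖y i t‖ ^ 2) * (-(2 * q) * inner ℝ (y i t) (y' i))) t := by
  unfold gaussianSum
  exact HasDerivAt.fun_sum fun i _ => hasDerivAt_exp_neg_mul_norm_sq q (hy i)

end

variable [Nonempty ι] {p κ : ℝ}

lemma continuous_pairWeight {X : Type*} [TopologicalSpace X] {y : ι → X → H}
    (hy : ∀ i, Continuous (y i)) (i j : ι) :
    Continuous fun x => pairWeight p κ (fun i => y i x) i j := by
  unfold pairWeight
  refine ((continuous_gaussianSum _ hy).rpow_const
    fun x => Or.inl (gaussianSum_pos _ _).ne').mul ?_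
  have := hy i
  have := hy j
  fun_prop

lemma pairWeight_nonneg (y : ι → H) (i j : ι) : 0 ≤ pairWeight p κ y i j := by
  have := gaussianSum_pos (p * κ) y
  unfold pairWeight
  positivity

lemma pairWeight_le (y : ι → H) (i j : ι) :
    pairWeight p κ y i j ≤ gaussianSum (p * κ) y ^ (1 / p) := by
  have hS := gaussianSum_pos (p * κ) y
  calc pairWeight p κ y i j
      ≤ gaussianSum (p * κ) y ^ (1 / p - 2) *
        (gaussianSum (p * κ) y * gaussianSum (p * κ) y) := by
        unfold pairWeight
        gcongr <;> exact exp_le_gaussianSum _ _ _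
    _ = gaussianSum (p * κ) y ^ (1 / p) := by
        rw [← sq, ← Real.rpow_natCast, ← Real.rpow_add hS]
        norm_num

lemma sum_pairWeight (y : ι → H) (i : ι) :
    ∑ j, pairWeight p κ y i j =
      gaussianSum (p * κ) y ^ (1 / p - 1) * Real.exp (-(p * κ) * ‖y i‖ ^ 2) := by
  have hS := gaussianSum_pos (p * κ) y
  have h : gaussianSum (p * κ) y ^ (1 / p - 1) =
      gaussianSum (p * κ) y ^ (1 / p - 2) * gaussianSum (p * κ) y := by
    rw [← Real.rpow_add_one hS.ne']
    norm_num
    ring_nf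
  rw [h]
  simp only [pairWeight, ← Finset.mul_sum, gaussianSum]
  ring

lemma gaussianSum_rpow_le (hp : 0 < p) (hκ : 0 ≤ κ) {R : ℝ} {w : ι → H} (hw : ∀ i, ‖w i‖ ≤ R)
    (z : H) :
    gaussianSum (p * κ) (fun i => z - w i) ^ (1 / p) ≤
      (Fintype.card ι * Real.exp (p * κ * R ^ 2)) ^ (1 / p) * Real.exp (-(κ / 2) * ‖z‖ ^ 2) := by
  have h1 : gaussianSum (p * κ) (fun i => z - w i) ≤
      Fintype.card ι * Real.exp (p * κ * R ^ 2) * Real.exp (-(κ / 2) * ‖z‖ ^ 2 * p) := by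
    have h2 : ∀ i, Real.exp (-(p * κ) * ‖z - w i‖ ^ 2) ≤
        Real.exp (p * κ * R ^ 2) * Real.exp (-(κ / 2) * ‖z‖ ^ 2 * p) := by
      intro i
      rw [← Real.exp_add, Real.exp_le_exp]
      have h3 : ‖z‖ ≤ ‖z - w i‖ + R := by
        have := norm_sub_norm_le z (w i)
        linarith [hw i]
      have h4 : ‖z‖ ^ 2 ≤ 2 * ‖z - w i‖ ^ 2 + 2 * R ^ 2 := by
        nlinarith [norm_nonneg z, sq_nonneg (‖z - w i‖ - R)]
      nlinarith [mul_nonneg hp.le hκ]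
    calc gaussianSum (p * κ) (fun i => z - w i) ≤ ∑ _i : ι,
        Real.exp (p * κ * R ^ 2) * Real.exp (-(κ / 2) * ‖z‖ ^ 2 * p) :=
          Finset.sum_le_sum fun i _ => h2 i
      _ = _ := by simp; ring
  calc _ ≤ (Fintype.card ι * Real.exp (p * κ * R ^ 2) *
        Real.exp (-(κ / 2) * ‖z‖ ^ 2 * p)) ^ (1 / p) :=
        Real.rpow_le_rpow (gaussianSum_pos _ _).le h1 (by positivity)
    _ = _ := by
        rw [Real.mul_rpow (by positivity) (by positivity), ← Real.exp_mul]
        congr 2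
        field_simp

lemma continuous_gaussianSum_rpow (w : ι → H) :
    Continuous fun z => gaussianSum (p * κ) (fun i => z - w i) ^ (1 / p) :=
  (continuous_gaussianSum _ fun i => by fun_prop).rpow_const
    fun z => Or.inl (gaussianSum_pos _ _).ne'

variable [InnerProductSpace ℝ H]

lemma hasDerivAt_gaussianSum_rpow (hp : 0 < p) {y : ι → ℝ → H} {y' : ι → H} {t : ℝ}
    (hy : ∀ i, HasDerivAt (y i) (y' i) t) :
    HasDerivAt (fun s => gaussianSum (p * κ) (fun i => y i s) ^ (1 / p))
      (∑ i, ∑ j, pairWeight p κ (fun i => y i t) i j * (-(2 * κ) * inner ℝ (y i t) (y' i))) t := by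
  have hS := gaussianSum_pos (p * κ) fun i => y i t
  convert! (hasDerivAt_gaussianSum (p * κ) hy).rpow_const (p := 1 / p) (Or.inl hS.ne') using 1
  simp only [← Finset.sum_mul, sum_pairWeight]
  simp only [Finset.sum_mul]
  refine Finset.sum_congr rfl fun i _ => ?_
  field_simp

lemma hasDerivAt_gaussianSum_rpow_mul_exp (hp : 0 < p) {y : ι → ℝ → H} {y' : ι → H} {t : ℝ}
    (hy : ∀ i, HasDerivAt (y i) (y' i) t) (i : ι) :
    HasDerivAt (fun s => gaussianSum (p * κ) (fun i => y i s) ^ (1 / p - 1) *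
        Real.exp (-(p * κ) * ‖y i s‖ ^ 2))
      (∑ j, pairWeight p κ (fun i => y i t) i j *
        (2 * κ * ((p - 1) * inner ℝ (y j t) (y' j) - p * inner ℝ (y i t) (y' i)))) t := by
  have hS := gaussianSum_pos (p * κ) fun i => y i t
  convert! ((hasDerivAt_gaussianSum (p * κ) hy).rpow_const (p := 1 / p - 1)
    (Or.inl hS.ne')).mul (hasDerivAt_exp_neg_mul_norm_sq (p * κ) (hy i)) using 1
  have h : ∑ j, pairWeight p κ (fun i => y i t) i j *
        (2 * κ * ((p - 1) * inner ℝ (y j t) (y' j) - p * inner ℝ (y i t) (y' i))) =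
      (∑ j, pairWeight p κ (fun i => y i t) i j * (2 * κ * (p - 1) * inner ℝ (y j t) (y' j))) -
      (∑ j, pairWeight p κ (fun i => y i t) i j) * (2 * κ * p * inner ℝ (y i t) (y' i)) := by
    rw [Finset.sum_mul, ← Finset.sum_sub_distrib]
    exact Finset.sum_congr rfl fun j _ => by ring
  rw [h, sum_pairWeight, sub_eq_add_neg, show (1 / p - 1 - 1 : ℝ) = 1 / p - 2 by ring]
  simp only [Finset.sum_mul, pairWeight]
  congr 1
  · refine Finset.sum_congr rfl fun j _ => ?_
    field_simp
    ring
  · ring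

lemma abs_pairWeight_mul_inner_le (hp : 0 < p) (hκ : 0 ≤ κ) {R R' : ℝ} {w : ι → H}
    (hw : ∀ i, ‖w i‖ ≤ R) {v : H} (hv : ‖v‖ ≤ R') (i j k : ι) (z : H) :
    |pairWeight p κ (fun i => z - w i) i j * inner ℝ (z - w k) v| ≤
      (Fintype.card ι * Real.exp (p * κ * R ^ 2)) ^ (1 / p) * R' *
        ((‖z‖ + R) * Real.exp (-(κ / 2) * ‖z‖ ^ 2)) := by
  have h1 : |inner ℝ (z - w k) v| ≤ (‖z‖ + R) * R' :=
    (abs_real_inner_le_norm _ _).trans <|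
      mul_le_mul ((norm_sub_le _ _).trans (by gcongr; exact hw k)) hv (norm_nonneg _)
        (add_nonneg (norm_nonneg _) ((norm_nonneg _).trans (hw k)))
  rw [abs_mul, abs_of_nonneg (pairWeight_nonneg _ _ _)]
  calc _ ≤ (Fintype.card ι * Real.exp (p * κ * R ^ 2)) ^ (1 / p) * Real.exp (-(κ / 2) * ‖z‖ ^ 2) *
        ((‖z‖ + R) * R') :=
        mul_le_mul ((pairWeight_le _ _ _).trans (gaussianSum_rpow_le hp hκ hw z)) h1
          (abs_nonneg _) (by positivity)
    _ = _ := by ring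

lemma continuous_pairWeight_mul_inner (w : ι → H) (v : H) (i j k : ι) :
    Continuous fun z => pairWeight p κ (fun i => z - w i) i j * inner ℝ (z - w k) v :=
  (continuous_pairWeight (fun i => by fun_prop) i j).mul (by fun_prop)

end GaussianSum

section Integral

variable {H : Type*} [NormedAddCommGroup H] [InnerProductSpace ℝ H] [FiniteDimensional ℝ H]
  [MeasurableSpace H] [BorelSpace H]

lemma integrable_exp_neg_mul_norm_sq {c : ℝ} (hc : 0 < c) :
    Integrable fun z : H => Real.exp (-c * ‖z‖ ^ 2) := by
  have h := (GaussianFourier.integrable_cexp_neg_mul_sq_norm_add (V := H) (b := (c : ℂ))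
    (by simpa) 0 0).norm
  refine h.congr (Filter.Eventually.of_forall fun z => ?_)
  simp only [Complex.norm_exp, zero_mul, add_zero]
  norm_cast

lemma integrable_add_norm_mul_exp_neg_mul_norm_sq {c : ℝ} (hc : 0 < c) (R : ℝ) :
    Integrable fun z : H => (‖z‖ + R) * Real.exp (-c * ‖z‖ ^ 2) := by
  refine ((integrable_exp_neg_mul_norm_sq (H := H) (half_pos hc)).const_mul
    (1 + |R| + 2 / c)).mono' (by fun_prop) (Filter.Eventually.of_forall fun z => ?_)
  have h1 : c / 2 * ‖z‖ ^ 2 + 1 ≤ Real.exp (c / 2 * ‖z‖ ^ 2) := Real.add_one_le_exp _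
  have h2 : |‖z‖ + R| ≤ (1 + |R| + 2 / c) * Real.exp (c / 2 * ‖z‖ ^ 2) := by
    have h3 : |‖z‖ + R| ≤ ‖z‖ + |R| := (abs_add_le _ _).trans (by simp)
    have h4 : ‖z‖ + |R| ≤ (1 + |R| + 2 / c) * (c / 2 * ‖z‖ ^ 2 + 1) := by
      have h5 : (1 + |R| + 2 / c) * (c / 2 * ‖z‖ ^ 2 + 1) =
        (1 + |R|) * (c / 2 * ‖z‖ ^ 2) + ‖z‖ ^ 2 + 1 + |R| + 2 / c := by field_simp; ring
      rw [h5]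
      have : 0 ≤ (1 + |R|) * (c / 2 * ‖z‖ ^ 2) := by positivity
      have : 0 < 2 / c := by positivity
      nlinarith [sq_nonneg (‖z‖ - 1)]
    exact h3.trans (h4.trans (by gcongr))
  rw [Real.norm_eq_abs, abs_mul, abs_of_pos (Real.exp_pos _)]
  calc |‖z‖ + R| * Real.exp (-c * ‖z‖ ^ 2)
      ≤ (1 + |R| + 2 / c) * Real.exp (c / 2 * ‖z‖ ^ 2) * Real.exp (-c * ‖z‖ ^ 2) := by gcongr
    _ = _ := by rw [mul_assoc, ← Real.exp_add]; ring_nf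

end Integral

section IntegralDerivative

variable {H : Type*} [NormedAddCommGroup H] [InnerProductSpace ℝ H] [FiniteDimensional ℝ H]
  [MeasurableSpace H] [BorelSpace H] {ι : Type*} [Fintype ι] [Nonempty ι] {p κ : ℝ}

lemma integrable_pairWeight_mul_inner (hp : 0 < p) (hκ : 0 < κ) (w : ι → H) (v : H) (i j k : ι) :
    Integrable fun z => pairWeight p κ (fun i => z - w i) i j * inner ℝ (z - w k) v := by
  have hw : ∀ i, ‖w i‖ ≤ ∑ j, ‖w j‖ := fun i =>
    Finset.single_le_sum (f := fun i => ‖w i‖) (fun _ _ => norm_nonneg _) (Finset.mem_univ i)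
  exact ((integrable_add_norm_mul_exp_neg_mul_norm_sq (H := H) (half_pos hκ) _).const_mul _).mono'
    (continuous_pairWeight_mul_inner w v i j k).aestronglyMeasurable
    (Filter.Eventually.of_forall fun z =>
      abs_pairWeight_mul_inner_le hp hκ.le hw le_rfl i j k z)

lemma integrable_gaussianSum_rpow (hp : 0 < p) (hκ : 0 < κ) (w : ι → H) :
    Integrable fun z => gaussianSum (p * κ) (fun i => z - w i) ^ (1 / p) := by
  have hw : ∀ i, ‖w i‖ ≤ ∑ j, ‖w j‖ := fun i =>
    Finset.single_le_sum (f := fun i => ‖w i‖) (fun _ _ => norm_nonneg _) (Finset.mem_univ i)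
  refine ((integrable_exp_neg_mul_norm_sq (H := H) (half_pos hκ)).const_mul
      ((Fintype.card ι * Real.exp (p * κ * (∑ j, ‖w j‖) ^ 2)) ^ (1 / p))).mono'
    (continuous_gaussianSum_rpow w).aestronglyMeasurable
    (Filter.Eventually.of_forall fun z => ?_)
  rw [Real.norm_of_nonneg (Real.rpow_nonneg (gaussianSum_pos _ _).le _)]
  exact gaussianSum_rpow_le hp hκ.le hw z

lemma integrable_pairWeight (hp : 0 < p) (hκ : 0 < κ) (w : ι → H) (i j : ι) :
    Integrable fun z => pairWeight p κ (fun i => z - w i) i j := by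
  refine (integrable_gaussianSum_rpow hp hκ w).mono'
    (continuous_pairWeight (fun i => by fun_prop) i j).aestronglyMeasurable
    (Filter.Eventually.of_forall fun z => ?_)
  rw [Real.norm_of_nonneg (pairWeight_nonneg _ _ _)]
  exact pairWeight_le _ _ _

lemma hasDerivAt_integral_gaussianSum_rpow (hp : 0 < p) (hκ : 0 < κ) {w w' : ι → ℝ → H}
    {R R' : ℝ} (hw : ∀ i t, HasDerivAt (w i) (w' i t) t) (hR : ∀ i t, ‖w i t‖ ≤ R)
    (hR' : ∀ i t, ‖w' i t‖ ≤ R') (t : ℝ) :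
    HasDerivAt (fun s => ∫ z, gaussianSum (p * κ) (fun i => z - w i s) ^ (1 / p))
      (∫ z, ∑ i, ∑ j, 2 * κ *
        (pairWeight p κ (fun i => z - w i t) i j * inner ℝ (z - w i t) (w' i t))) t := by
  refine (hasDerivAt_integral_of_dominated_loc_of_deriv_le
    (F := fun s z => gaussianSum (p * κ) (fun i => z - w i s) ^ (1 / p))
    (F' := fun s z => ∑ i, ∑ j, 2 * κ *
        (pairWeight p κ (fun i => z - w i s) i j * inner ℝ (z - w i s) (w' i s)))
    (bound := fun z => ∑ _i : ι, ∑ _j : ι, 2 * κ *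
      ((Fintype.card ι * Real.exp (p * κ * R ^ 2)) ^ (1 / p) * R' *
        ((‖z‖ + R) * Real.exp (-(κ / 2) * ‖z‖ ^ 2))))
    Filter.univ_mem
    (Filter.Eventually.of_forall fun s => (continuous_gaussianSum_rpow _).aestronglyMeasurable)
    (integrable_gaussianSum_rpow hp hκ _) ?_ ?_ ?_ ?_).2
  · refine Continuous.aestronglyMeasurable ?_
    exact continuous_finsetSum _ fun i _ => continuous_finsetSum _ fun j _ =>
      (continuous_pairWeight_mul_inner _ _ _ _ _).const_mul _
  · refine Filter.Eventually.of_forall fun z s _ => ?_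
    refine (norm_sum_le _ _).trans (Finset.sum_le_sum fun i _ => ?_)
    refine (norm_sum_le _ _).trans (Finset.sum_le_sum fun j _ => ?_)
    rw [norm_mul, Real.norm_of_nonneg (by positivity : (0 : ℝ) ≤ 2 * κ)]
    gcongr
    exact abs_pairWeight_mul_inner_le hp hκ.le (fun i => hR i s) (hR' i s) i j i z
  · exact integrable_finsetSum _ fun i _ => integrable_finsetSum _ fun j _ =>
      ((integrable_add_norm_mul_exp_neg_mul_norm_sq (half_pos hκ) _).const_mul _).const_mul _
  · refine Filter.Eventually.of_forall fun z s _ => ?_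
    convert! hasDerivAt_gaussianSum_rpow (κ := κ) hp (y := fun i s => z - w i s)
      (fun i => (hw i s).const_sub z) using 1
    refine Finset.sum_congr rfl fun i _ => Finset.sum_congr rfl fun j _ => ?_
    rw [inner_neg_right]
    ring

lemma integrable_lineDeriv_gaussianSum_rpow_mul_exp (hp : 0 < p) (hκ : 0 < κ) (w : ι → H)
    (v : H) (i : ι) :
    Integrable fun z => ∑ j, pairWeight p κ (fun i => z - w i) i j *
      (2 * κ * ((p - 1) * inner ℝ (z - w j) v - p * inner ℝ (z - w i) v)) := by
  refine integrable_finsetSum _ fun j _ => ?_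
  refine (((integrable_pairWeight_mul_inner hp hκ w v i j j).const_mul (2 * κ * (p - 1))).sub
    ((integrable_pairWeight_mul_inner hp hκ w v i j i).const_mul (2 * κ * p))).congr
    (Filter.Eventually.of_forall fun z => ?_)
  simp only [Pi.sub_apply]
  ring

/-- The integral over the whole space of the derivative of
`gaussianSum (p * κ) (z - w ·) ^ (1 / p - 1) * exp (-p κ ‖z - w i‖²)` in the direction `v`
vanishes. -/
lemma integral_lineDeriv_gaussianSum_rpow_mul_exp (hp : 0 < p) (hκ : 0 < κ) (w : ι → H) (v : H)
    (i : ι) :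
    ∫ z, ∑ j, pairWeight p κ (fun i => z - w i) i j *
      (2 * κ * ((p - 1) * inner ℝ (z - w j) v - p * inner ℝ (z - w i) v)) = 0 := by
  have h := integral_bilinear_hasLineDerivAt_right_eq_neg_left_of_integrable
    (μ := (volume : Measure H)) (f := fun _ => (1 : ℝ)) (f' := fun _ => 0)
    (g := fun z => gaussianSum (p * κ) (fun i => z - w i) ^ (1 / p - 1) *
        Real.exp (-(p * κ) * ‖z - w i‖ ^ 2))
    (g' := fun z => ∑ j, pairWeight p κ (fun i => z - w i) i j *
      (2 * κ * ((p - 1) * inner ℝ (z - w j) v - p * inner ℝ (z - w i) v)))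
    (v := v) (B := ContinuousLinearMap.mul ℝ ℝ) (by simp) ?_ ?_ ?_ ?_
  · simpa using h
  · simp only [ContinuousLinearMap.mul_apply', one_mul]
    exact integrable_lineDeriv_gaussianSum_rpow_mul_exp hp hκ w v i
  · simp only [ContinuousLinearMap.mul_apply', one_mul, ← sum_pairWeight]
    exact integrable_finsetSum _ fun j _ => integrable_pairWeight hp hκ w i j
  · intro z _
    unfold HasLineDerivAt
    exact hasDerivAt_const (0 : ℝ) (1 : ℝ)
  · intro z _
    have hy : ∀ i, HasDerivAt (fun s : ℝ => z + s • v - w i) v 0 := fun i => by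
      simpa using (((hasDerivAt_id (0 : ℝ)).smul_const v).const_add z).sub_const (w i)
    unfold HasLineDerivAt
    simpa using hasDerivAt_gaussianSum_rpow_mul_exp (κ := κ) hp hy i

lemma integral_sum_pairWeight_mul_inner (hp : 0 < p) (hκ : 0 < κ) (w v : ι → H) :
    ∫ z, ∑ i, ∑ j, 2 * κ * (pairWeight p κ (fun i => z - w i) i j * inner ℝ (z - w i) (v i)) =
      ∫ z, 2 * κ * (p - 1) *
        ∑ i, ∑ j, pairWeight p κ (fun i => z - w i) i j * inner ℝ (w i - w j) (v i) := by
  have h : ∫ z, ∑ i, ∑ j, pairWeight p κ (fun i => z - w i) i j *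
      (2 * κ * ((p - 1) * inner ℝ (z - w j) (v i) - p * inner ℝ (z - w i) (v i))) = 0 := by
    rw [integral_finsetSum _ fun i _ =>
      integrable_lineDeriv_gaussianSum_rpow_mul_exp hp hκ w (v i) i]
    exact Finset.sum_eq_zero fun i _ =>
      integral_lineDeriv_gaussianSum_rpow_mul_exp hp hκ w (v i) i
  rw [← add_zero (∫ z, _), ← h, ← integral_add]
  · refine integral_congr_ae (Filter.Eventually.of_forall fun z => ?_)
    simp only [Finset.mul_sum, ← Finset.sum_add_distrib]
    refine Finset.sum_congr rfl fun i _ => Finset.sum_congr rfl fun j _ => ?_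
    rw [← sub_sub_sub_cancel_left (w j) (w i) z, inner_sub_left (z - w j)]
    ring
  · exact integrable_finsetSum _ fun i _ => integrable_finsetSum _ fun j _ =>
      (integrable_pairWeight_mul_inner hp hκ w (v i) i j i).const_mul _
  · exact integrable_finsetSum _ fun i _ =>
      integrable_lineDeriv_gaussianSum_rpow_mul_exp hp hκ w (v i) i

/-- If `∑ i, ∑ j, e i * e j * ⟪w i - w j, w' i⟫ ≥ 0` along a bounded motion `w` of finitely many
centres, where `e i = exp (-p κ ‖z - w i‖²)`, then the integral of the `p`-norm of the Gaussian bumps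
around the centres is nondecreasing. -/
lemma integral_gaussianSum_rpow_le {a b : ℝ} (hab : a ≤ b) (hp : 1 ≤ p) (hκ : 0 < κ)
    {w w' : ι → ℝ → H} {R R' : ℝ} (hw : ∀ i t, HasDerivAt (w i) (w' i t) t)
    (hR : ∀ i t, ‖w i t‖ ≤ R) (hR' : ∀ i t, ‖w' i t‖ ≤ R')
    (hpos : ∀ t ∈ Set.Ioo a b, ∀ z, 0 ≤ ∑ i, ∑ j,
      Real.exp (-(p * κ) * ‖z - w i t‖ ^ 2) * Real.exp (-(p * κ) * ‖z - w j t‖ ^ 2) *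
        inner ℝ (w i t - w j t) (w' i t)) :
    ∫ z, gaussianSum (p * κ) (fun i => z - w i a) ^ (1 / p) ≤
      ∫ z, gaussianSum (p * κ) (fun i => z - w i b) ^ (1 / p) := by
  have hp0 : 0 < p := by linarith
  have hd := hasDerivAt_integral_gaussianSum_rpow hp0 hκ hw hR hR'
  refine monotoneOn_of_deriv_nonneg (convex_Icc a b)
    (fun t _ => (hd t).continuousAt.continuousWithinAt)
    (fun t _ => (hd t).differentiableAt.differentiableWithinAt) (fun t ht => ?_)
    (Set.left_mem_Icc.2 hab) (Set.right_mem_Icc.2 hab) hab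
  rw [interior_Icc] at ht
  rw [(hd t).deriv, integral_sum_pairWeight_mul_inner hp0 hκ (fun i => w i t) (fun i => w' i t)]
  refine integral_nonneg fun z => mul_nonneg
    (mul_nonneg (by positivity) (sub_nonneg.2 hp)) ?_
  simp only [pairWeight, mul_assoc, ← Finset.mul_sum]
  refine mul_nonneg (Real.rpow_nonneg (gaussianSum_pos _ _).le _) ?_
  simpa only [mul_assoc, Finset.mul_sum] using hpos t ht z

end IntegralDerivative

section Rotation

variable {E : Type*} [NormedAddCommGroup E] [InnerProductSpace ℝ E]
  {ι ι' : Type*} [Fintype ι] [Fintype ι']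

/-- Tilting a product weight by `exp (-m ⟪a, b⟫)` with `m ≥ 0` makes `a` and `b` negatively
correlated. -/
lemma sum_exp_mul_exp_mul_inner_nonpos (a : ι → E) (b : ι' → E) (α : ι → ℝ) (β : ι' → ℝ) {m : ℝ}
    (hm : 0 ≤ m) :
    ∑ x : ι × ι', ∑ y : ι × ι',
      Real.exp (α x.1 + β x.2 - m * inner ℝ (a x.1) (b x.2)) *
        Real.exp (α y.1 + β y.2 - m * inner ℝ (a y.1) (b y.2)) *
          inner ℝ (a x.1 - a y.1) (b x.2) ≤ 0 := by
  set e : ι → ι' → ℝ := fun i j => Real.exp (α i + β j - m * inner ℝ (a i) (b j)) with he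
  rw [← Fintype.sum_prod_type']
  set f : (ι × ι') × (ι × ι') → ℝ := fun x =>
    e x.1.1 x.1.2 * e x.2.1 x.2.2 * inner ℝ (a x.1.1 - a x.2.1) (b x.1.2) with hf
  change ∑ x, f x ≤ 0
  let σ : (ι × ι') × (ι × ι') ≃ (ι × ι') × (ι × ι') :=
    ⟨fun x => ((x.2.1, x.1.2), (x.1.1, x.2.2)), fun x => ((x.2.1, x.1.2), (x.1.1, x.2.2)),
      fun _ => rfl, fun _ => rfl⟩
  let τ : (ι × ι') × (ι × ι') ≃ (ι × ι') × (ι × ι') := Equiv.prodComm _ _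
  have h1 : ∑ x, f (σ x) = ∑ x, f x := Equiv.sum_comp σ f
  have h2 : ∑ x, f (τ x) = ∑ x, f x := Equiv.sum_comp τ f
  have h3 : ∑ x, f (τ (σ x)) = ∑ x, f x := (Equiv.sum_comp σ fun x => f (τ x)).trans h2
  have h4 : ∑ x, (f x + f (σ x) + f (τ x) + f (τ (σ x))) ≤ 0 := by
    refine Finset.sum_nonpos fun x _ => ?_
    obtain ⟨⟨i, j⟩, ⟨k, l⟩⟩ := x
    set d := inner ℝ (a i - a k) (b j - b l) with hd
    have h5 : f ((i, j), (k, l)) + f (σ ((i, j), (k, l))) + f (τ ((i, j), (k, l))) +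
        f (τ (σ ((i, j), (k, l)))) = (e i j * e k l - e k j * e i l) * d := by
      simp only [hf, σ, τ, hd, Equiv.coe_fn_mk, Equiv.prodComm_apply, Prod.swap_prod_mk,
        inner_sub_left, inner_sub_right]
      ring
    have h6 : e k j * e i l = e i j * e k l * Real.exp (m * d) := by
      simp only [he, hd, ← Real.exp_add, inner_sub_left, inner_sub_right]
      ring_nf
    have h7 : 0 < e i j * e k l := mul_pos (Real.exp_pos _) (Real.exp_pos _)
    rw [h5, h6]
    rcases le_total 0 d with h | h
    · have : 1 ≤ Real.exp (m * d) := Real.one_le_exp (mul_nonneg hm h)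
      nlinarith [mul_nonneg h7.le h, mul_nonneg (mul_nonneg h7.le h) (sub_nonneg.2 this)]
    · have : Real.exp (m * d) ≤ 1 := Real.exp_le_one_iff.2 (mul_nonpos_of_nonneg_of_nonpos hm h)
      nlinarith [mul_nonneg (mul_nonneg h7.le (neg_nonneg.2 h)) (sub_nonneg.2 this)]
  simp only [Finset.sum_add_distrib, h1, h2, h3] at h4
  linarith

variable [FiniteDimensional ℝ E] [MeasurableSpace E] [BorelSpace E] [Nonempty ι] [Nonempty ι']
  {p κ : ℝ}

lemma integral_gaussianSum_rpow_add_le (hp : 1 ≤ p) (hκ : 0 < κ) (a : ι → E) (b : ι' → E) :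
    ∫ z : WithLp 2 (E × E), gaussianSum (p * κ)
        (fun x : ι × ι' => z - WithLp.toLp 2 (a x.1 + b x.2, 0)) ^ (1 / p) ≤
      ∫ z : WithLp 2 (E × E), gaussianSum (p * κ)
        (fun x : ι × ι' => z - WithLp.toLp 2 (a x.1, b x.2)) ^ (1 / p) := by
  let P : E → WithLp 2 (E × E) := fun v => WithLp.toLp 2 (v, 0)
  let Q : E → WithLp 2 (E × E) := fun v => WithLp.toLp 2 (0, v)
  let w : ι × ι' → ℝ → WithLp 2 (E × E) := fun x t =>
    P (a x.1) + (Real.cos t • P (b x.2) + Real.sin t • Q (b x.2))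
  let w' : ι × ι' → ℝ → WithLp 2 (E × E) := fun x t =>
    -Real.sin t • P (b x.2) + Real.cos t • Q (b x.2)
  have hPP : ∀ u v, inner ℝ (P u) (P v) = inner ℝ u v := by simp [P]
  have hQQ : ∀ u v, inner ℝ (Q u) (Q v) = inner ℝ u v := by simp [Q]
  have hPQ : ∀ u v, inner ℝ (P u) (Q v) = 0 := by simp [P, Q]
  have hQP : ∀ u v, inner ℝ (Q u) (P v) = 0 := by simp [P, Q]
  have hP : ∀ v, ‖P v‖ = ‖v‖ := by simp [P]
  have hQ : ∀ v, ‖Q v‖ = ‖v‖ := by simp [Q]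
  have hb : ∀ j, ‖b j‖ ≤ ∑ j, ‖b j‖ := fun i =>
    Finset.single_le_sum (f := fun i => ‖b i‖) (fun _ _ => norm_nonneg _) (Finset.mem_univ i)
  have ha : ∀ j, ‖a j‖ ≤ ∑ j, ‖a j‖ := fun i =>
    Finset.single_le_sum (f := fun i => ‖a i‖) (fun _ _ => norm_nonneg _) (Finset.mem_univ i)
  have hrot : ∀ (c s : ℝ) (v : E), |c| ≤ 1 → |s| ≤ 1 → ‖c • P v + s • Q v‖ ≤ ‖v‖ + ‖v‖ := by
    intro c s v hc hs
    refine (norm_add_le _ _).trans ?_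
    rw [norm_smul, norm_smul, hP, hQ, Real.norm_eq_abs, Real.norm_eq_abs]
    gcongr <;> exact mul_le_of_le_one_left (norm_nonneg _) ‹_›
  have key := integral_gaussianSum_rpow_le (p := p) (κ := κ) (w := w) (w' := w')
    (R := ∑ i, ‖a i‖ + (∑ j, ‖b j‖ + ∑ j, ‖b j‖)) (R' := ∑ j, ‖b j‖ + ∑ j, ‖b j‖)
    Real.pi_div_two_pos.le hp hκ ?_ ?_ ?_ ?_
  · have h0 : ∀ x : ι × ι', w x 0 = WithLp.toLp 2 (a x.1 + b x.2, 0) := by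
      intro x
      simp [w, P, ← WithLp.toLp_add]
    have h1 : ∀ x : ι × ι', w x (π / 2) = WithLp.toLp 2 (a x.1, b x.2) := by
      intro x
      simp [w, P, Q, ← WithLp.toLp_add]
    simpa only [h0, h1] using key
  · intro x t
    exact (((Real.hasDerivAt_cos t).smul_const _).add
      ((Real.hasDerivAt_sin t).smul_const _)).const_add _
  · intro x t
    refine (norm_add_le _ _).trans (add_le_add ?_ ?_)
    · rw [hP]; exact ha _
    · exact (hrot _ _ _ (Real.abs_cos_le_one t) (Real.abs_sin_le_one t)).trans
        (add_le_add (hb _) (hb _))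
  · intro x t
    exact (hrot _ _ _ (by simpa using Real.abs_sin_le_one t) (Real.abs_cos_le_one t)).trans
        (add_le_add (hb _) (hb _))
  · intro t ht z
    have hs : 0 ≤ Real.sin t := (Real.sin_pos_of_pos_of_lt_pi ht.1 (by linarith [ht.2, pi_pos])).le
    have hc : 0 ≤ Real.cos t := Real.cos_nonneg_of_mem_Icc ⟨by linarith [ht.1, pi_pos], ht.2.le⟩
    have hin : ∀ x y : ι × ι', inner ℝ (w x t - w y t) (w' x t) =
        -Real.sin t * inner ℝ (a x.1 - a y.1) (b x.2) := by
      intro x y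
      simp only [w, w', inner_sub_left, inner_add_left, inner_add_right, inner_smul_left,
        inner_smul_right, hPP, hQQ, hPQ, hQP, conj_trivial]
      ring
    have hexp : ∀ x : ι × ι', -(p * κ) * ‖z - w x t‖ ^ 2 =
        (-(p * κ) * (‖z‖ ^ 2 - 2 * inner ℝ z (P (a x.1)) + ‖a x.1‖ ^ 2)) +
        (-(p * κ) * (‖b x.2‖ ^ 2 - 2 * (Real.cos t * inner ℝ z (P (b x.2)) +
          Real.sin t * inner ℝ z (Q (b x.2))))) -
        2 * (p * κ) * Real.cos t * inner ℝ (a x.1) (b x.2) := by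
      intro x
      have h : ‖w x t‖ ^ 2 = ‖a x.1‖ ^ 2 + ‖b x.2‖ ^ 2 +
          2 * Real.cos t * inner ℝ (a x.1) (b x.2) := by
        rw [← real_inner_self_eq_norm_sq, ← real_inner_self_eq_norm_sq,
          ← real_inner_self_eq_norm_sq]
        simp only [w, inner_add_left, inner_add_right, inner_smul_left,
          inner_smul_right, hPP, hQQ, hPQ, hQP, conj_trivial]
        rw [real_inner_comm (a x.1) (b x.2)]
        linear_combination inner ℝ (b x.2) (b x.2) * Real.sin_sq_add_cos_sq t
      rw [norm_sub_sq_real, h]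
      simp only [w, inner_add_right, inner_smul_right]
      ring
    simp only [hin, hexp]
    have := sum_exp_mul_exp_mul_inner_nonpos a b
      (fun i => -(p * κ) * (‖z‖ ^ 2 - 2 * inner ℝ z (P (a i)) + ‖a i‖ ^ 2))
      (fun j => -(p * κ) * (‖b j‖ ^ 2 - 2 * (Real.cos t * inner ℝ z (P (b j)) +
          Real.sin t * inner ℝ z (Q (b j))))) (m := 2 * (p * κ) * Real.cos t) (by positivity)
    have h := mul_nonneg_of_nonpos_of_nonpos (neg_nonpos.2 hs) this
    simp only [Finset.mul_sum] at h
    simpa only [mul_left_comm (-Real.sin t)] using h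

end Rotation

lemma exists_seq_subset_closure_range {X : Type*} [TopologicalSpace X]
    [SecondCountableTopology X] {A : Set X} (hA : A.Nonempty) :
    ∃ a : ℕ → X, (∀ i, a i ∈ A) ∧ A ⊆ closure (range a) := by
  have := hA.to_subtype
  refine ⟨fun i => TopologicalSpace.denseSeq A i, fun i => Subtype.prop _, fun x hx => ?_⟩
  have h := TopologicalSpace.denseRange_denseSeq A ⟨x, hx⟩
  have h2 := image_closure_subset_closure_image continuous_subtype_val (mem_image_of_mem _ h)
  rwa [← range_comp] at h2

section InfDist

variable {E : Type*} [NormedAddCommGroup E] {κ : ℝ}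

lemma ofReal_exp_infDist_mul (A B : Set E) (x y : E) :
    ENNReal.ofReal (Real.exp (-κ * Metric.infDist x A ^ 2)) *
        ENNReal.ofReal (Real.exp (-κ * Metric.infDist y B ^ 2)) =
      ENNReal.ofReal (Real.exp (-κ * (Metric.infDist x A ^ 2 + Metric.infDist y B ^ 2))) := by
  rw [← ENNReal.ofReal_mul (Real.exp_pos _).le, ← Real.exp_add, mul_add]

lemma tendsto_infDist_range_add {A B : Set E} (hA : A.Nonempty) (hB : B.Nonempty) {a b : ℕ → E}
    (haA : ∀ i, a i ∈ A) (hbB : ∀ i, b i ∈ B) (hAa : A ⊆ closure (range a))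
    (hBb : B ⊆ closure (range b)) (x : E) :
    Filter.Tendsto (fun k : ℕ => Metric.infDist x
      (range fun y : Fin (k + 1) × Fin (k + 1) => a y.1 + b y.2)) Filter.atTop
      (nhds (Metric.infDist x (A + B))) := by
  rw [Metric.tendsto_atTop]
  intro ε hε
  obtain ⟨_, ⟨u, hu, v, hv, rfl⟩, huv⟩ :=
    (Metric.infDist_lt_iff (hA.add hB)).1 (lt_add_of_pos_right (Metric.infDist x (A + B))
      (by positivity : 0 < ε / 3))
  obtain ⟨_, ⟨i, rfl⟩, hi⟩ := Metric.mem_closure_iff.1 (hAa hu) (ε / 3) (by positivity)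
  obtain ⟨_, ⟨j, rfl⟩, hj⟩ := Metric.mem_closure_iff.1 (hBb hv) (ε / 3) (by positivity)
  refine ⟨max i j, fun k hk => ?_⟩
  have h1 : Metric.infDist x (A + B) ≤ Metric.infDist x
      (range fun y : Fin (k + 1) × Fin (k + 1) => a y.1 + b y.2) := by
    refine Metric.infDist_le_infDist_of_subset ?_ (range_nonempty _)
    rintro _ ⟨y, rfl⟩
    exact add_mem_add (haA _) (hbB _)
  have h2 : Metric.infDist x (range fun y : Fin (k + 1) × Fin (k + 1) => a y.1 + b y.2) ≤
      dist x (a i + b j) :=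
    Metric.infDist_le_dist_of_mem
      ⟨(⟨i, by lia⟩, ⟨j, by lia⟩), rfl⟩
  have h3 : dist (u + v) (a i + b j) ≤ dist u (a i) + dist v (b j) := dist_add_add_le _ _ _ _
  have h4 := dist_triangle x (u + v) (a i + b j)
  rw [Real.dist_eq, abs_of_nonneg (by linarith)]
  change dist x (u + v) < _ at huv
  linarith

lemma measurable_ofReal_exp_infDist [MeasurableSpace E] [BorelSpace E] (A : Set E) :
    Measurable fun x => ENNReal.ofReal (Real.exp (-κ * Metric.infDist x A ^ 2)) := by
  have := Metric.continuous_infDist_pt A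
  fun_prop

variable {ι ι' : Type*} [Fintype ι] [Fintype ι'] [Nonempty ι] [Nonempty ι']

lemma exp_infDist_range_le_gaussianSum_rpow {p : ℝ} (hp : 0 < p) (c : ι → E)
    (z : WithLp 2 (E × E)) :
    Real.exp (-κ * (Metric.infDist z.fst (range c) ^ 2 + Metric.infDist z.snd {0} ^ 2)) ≤
      gaussianSum (p * κ) (fun i => z - WithLp.toLp 2 (c i, 0)) ^ (1 / p) := by
  obtain ⟨_, ⟨i, rfl⟩, hi⟩ :=
    (finite_range c).isCompact.exists_infDist_eq_dist (range_nonempty c) z.fst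
  calc _ = Real.exp (-(p * κ) * ‖z - WithLp.toLp 2 (c i, 0)‖ ^ 2) ^ (1 / p) := by
        rw [← Real.exp_mul, WithLp.prod_norm_sq_eq_of_L2, hi, dist_eq_norm]
        congr 1
        simp
        field_simp
    _ ≤ _ := Real.rpow_le_rpow (Real.exp_pos _).le
        (exp_le_gaussianSum (p * κ) (fun i => z - WithLp.toLp 2 (c i, 0)) i) (by positivity)

lemma gaussianSum_rpow_le_exp_infDist_range {p : ℝ} (hp : 0 < p) (hκ : 0 ≤ κ) (a : ι → E)
    (b : ι' → E) (z : WithLp 2 (E × E)) :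
    gaussianSum (p * κ) (fun x : ι × ι' => z - WithLp.toLp 2 (a x.1, b x.2)) ^ (1 / p) ≤
      (Fintype.card (ι × ι') : ℝ) ^ (1 / p) *
        Real.exp (-κ * (Metric.infDist z.fst (range a) ^ 2 +
          Metric.infDist z.snd (range b) ^ 2)) := by
  set d := Metric.infDist z.fst (range a) ^ 2 + Metric.infDist z.snd (range b) ^ 2 with hd
  have h : gaussianSum (p * κ) (fun x : ι × ι' => z - WithLp.toLp 2 (a x.1, b x.2)) ≤
      Fintype.card (ι × ι') * Real.exp (-κ * d * p) := by
    have h1 : ∀ x : ι × ι', Real.exp (-(p * κ) * ‖z - WithLp.toLp 2 (a x.1, b x.2)‖ ^ 2) ≤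
        Real.exp (-κ * d * p) := by
      intro x
      have h2 : d ≤ ‖z - WithLp.toLp 2 (a x.1, b x.2)‖ ^ 2 := by
        rw [WithLp.prod_norm_sq_eq_of_L2, hd]
        refine add_le_add (pow_le_pow_left₀ Metric.infDist_nonneg ?_ 2)
          (pow_le_pow_left₀ Metric.infDist_nonneg ?_ 2)
        · simpa [dist_eq_norm] using Metric.infDist_le_dist_of_mem (x := z.fst) (mem_range_self x.1)
        · simpa [dist_eq_norm] using Metric.infDist_le_dist_of_mem (x := z.snd) (mem_range_self x.2)
      rw [Real.exp_le_exp]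
      nlinarith [mul_le_mul_of_nonneg_left h2 (mul_nonneg hp.le hκ)]
    refine (Finset.sum_le_sum fun x _ => h1 x).trans_eq ?_
    simp
  refine (Real.rpow_le_rpow (gaussianSum_pos _ _).le h (by positivity)).trans_eq ?_
  rw [Real.mul_rpow (by positivity) (by positivity), ← Real.exp_mul]
  congr 2
  field_simp

end InfDist

section DistIntegral

variable {E : Type*} [NormedAddCommGroup E] [InnerProductSpace ℝ E] [FiniteDimensional ℝ E]
  [MeasurableSpace E] [BorelSpace E] {κ : ℝ}

/-- The integral of `exp (-κ dist(x, A)²)` over the whole space. -/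
def gaussianDistIntegral (κ : ℝ) (A : Set E) : ℝ≥0∞ :=
  ∫⁻ x, ENNReal.ofReal (Real.exp (-κ * Metric.infDist x A ^ 2))

lemma gaussianDistIntegral_mono (hκ : 0 ≤ κ) {A B : Set E} (hA : A.Nonempty) (h : A ⊆ B) :
    gaussianDistIntegral κ A ≤ gaussianDistIntegral κ B := by
  refine lintegral_mono fun x => ENNReal.ofReal_le_ofReal (Real.exp_le_exp.2 ?_)
  have h1 : Metric.infDist x B ^ 2 ≤ Metric.infDist x A ^ 2 :=
    pow_le_pow_left₀ Metric.infDist_nonneg (Metric.infDist_le_infDist_of_subset h hA) 2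
  nlinarith

lemma gaussianDistIntegral_neg (A : Set E) :
    gaussianDistIntegral κ (-A) = gaussianDistIntegral κ A := by
  have h : ∀ x, Metric.infDist x (-A) = Metric.infDist (-x) A := fun x => by
    simpa using (Metric.infDist_image (IsometryEquiv.neg E).isometry (x := -x) (t := A))
  simp only [gaussianDistIntegral, h]
  exact lintegral_neg_eq_self (fun x : E => ENNReal.ofReal (Real.exp (-κ * Metric.infDist x A ^ 2)))

lemma gaussianDistIntegral_zero (hκ : 0 < κ) :
    gaussianDistIntegral κ ({0} : Set E) =
      ENNReal.ofReal ((π / κ) ^ (Module.finrank ℝ E / 2 : ℝ)) := by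
  simp only [gaussianDistIntegral, Metric.infDist_singleton, dist_zero_right]
  rw [← GaussianFourier.integral_rexp_neg_mul_sq_norm hκ,
    ofReal_integral_eq_lintegral_ofReal (integrable_exp_neg_mul_norm_sq hκ)
      (Filter.Eventually.of_forall fun z => (Real.exp_pos _).le)]

lemma lintegral_withLp_prod_mul {f g : E → ℝ≥0∞} (hf : Measurable f) (hg : Measurable g) :
    ∫⁻ z : WithLp 2 (E × E), f z.fst * g z.snd = (∫⁻ x, f x) * ∫⁻ x, g x := by
  have hm : Measurable fun z : WithLp 2 (E × E) => f z.fst * g z.snd := by fun_prop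
  rw [← lintegral_prod_mul hf.aemeasurable hg.aemeasurable, ← Measure.volume_eq_prod,
    ← (WithLp.volume_preserving_toLp E E).lintegral_comp hm]
  rfl

variable {ι ι' : Type*} [Fintype ι] [Fintype ι'] [Nonempty ι] [Nonempty ι']

lemma gaussianDistIntegral_range_add_mul_le_rpow {p : ℝ} (hp : 1 ≤ p) (hκ : 0 < κ) (a : ι → E)
    (b : ι' → E) :
    gaussianDistIntegral κ (range fun x : ι × ι' => a x.1 + b x.2) *
        gaussianDistIntegral κ ({0} : Set E) ≤
      ENNReal.ofReal ((Fintype.card (ι × ι') : ℝ) ^ (1 / p)) *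
        (gaussianDistIntegral κ (range a) * gaussianDistIntegral κ (range b)) := by
  have hp0 : 0 < p := by linarith
  have hnn : ∀ (w : ι × ι' → WithLp 2 (E × E)),
      0 ≤ᵐ[volume] fun z => gaussianSum (p * κ) (fun i => z - w i) ^ (1 / p) := fun w =>
    Filter.Eventually.of_forall fun z => Real.rpow_nonneg (gaussianSum_pos _ _).le _
  simp only [gaussianDistIntegral]
  rw [← lintegral_withLp_prod_mul (measurable_ofReal_exp_infDist _)
      (measurable_ofReal_exp_infDist _),
    ← lintegral_withLp_prod_mul (measurable_ofReal_exp_infDist _)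
      (measurable_ofReal_exp_infDist _), ← lintegral_const_mul' _ _ ENNReal.ofReal_ne_top]
  simp only [ofReal_exp_infDist_mul]
  calc _ ≤ ∫⁻ z : WithLp 2 (E × E), ENNReal.ofReal (gaussianSum (p * κ)
          (fun x : ι × ι' => z - WithLp.toLp 2 (a x.1 + b x.2, 0)) ^ (1 / p)) :=
        lintegral_mono fun z => ENNReal.ofReal_le_ofReal
          (exp_infDist_range_le_gaussianSum_rpow hp0 _ z)
    _ ≤ ∫⁻ z : WithLp 2 (E × E), ENNReal.ofReal (gaussianSum (p * κ)
          (fun x : ι × ι' => z - WithLp.toLp 2 (a x.1, b x.2)) ^ (1 / p)) := by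
        rw [← ofReal_integral_eq_lintegral_ofReal (integrable_gaussianSum_rpow hp0 hκ _) (hnn _),
          ← ofReal_integral_eq_lintegral_ofReal (integrable_gaussianSum_rpow hp0 hκ _) (hnn _)]
        exact ENNReal.ofReal_le_ofReal (integral_gaussianSum_rpow_add_le hp hκ a b)
    _ ≤ _ := by
        refine lintegral_mono fun z => ?_
        rw [← ENNReal.ofReal_mul (by positivity)]
        exact ENNReal.ofReal_le_ofReal (gaussianSum_rpow_le_exp_infDist_range hp0 hκ.le a b z)

lemma gaussianDistIntegral_range_add_mul_le (hκ : 0 < κ) (a : ι → E) (b : ι' → E) :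
    gaussianDistIntegral κ (range fun x : ι × ι' => a x.1 + b x.2) *
        gaussianDistIntegral κ ({0} : Set E) ≤
      gaussianDistIntegral κ (range a) * gaussianDistIntegral κ (range b) := by
  have h1 : Filter.Tendsto (fun m : ℕ => ENNReal.ofReal
      ((Fintype.card (ι × ι') : ℝ) ^ (1 / ((m : ℝ) + 1)))) Filter.atTop (nhds 1) := by
    have h0 : (Fintype.card (ι × ι') : ℝ) ≠ 0 := Nat.cast_ne_zero.2 Fintype.card_ne_zero
    have h := ENNReal.tendsto_ofReal ((Real.continuousAt_const_rpow (b := 0) h0).tendsto.comp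
      (tendsto_one_div_add_atTop_nhds_zero_nat (𝕜 := ℝ)))
    rwa [Real.rpow_zero, ENNReal.ofReal_one] at h
  have h2 := ENNReal.Tendsto.mul_const (b := gaussianDistIntegral κ (range a) *
    gaussianDistIntegral κ (range b)) h1 (Or.inl one_ne_zero)
  rw [one_mul] at h2
  exact ge_of_tendsto' h2 fun m =>
    gaussianDistIntegral_range_add_mul_le_rpow (by linarith [m.cast_nonneg (α := ℝ)]) hκ a b

theorem gaussianDistIntegral_add_mul_le (hκ : 0 < κ) {A B : Set E} (hA : A.Nonempty)
    (hB : B.Nonempty) :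
    gaussianDistIntegral κ (A + B) * gaussianDistIntegral κ ({0} : Set E) ≤
      gaussianDistIntegral κ A * gaussianDistIntegral κ B := by
  obtain ⟨a, haA, hAa⟩ := exists_seq_subset_closure_range hA
  obtain ⟨b, hbB, hBb⟩ := exists_seq_subset_closure_range hB
  have h0 : gaussianDistIntegral κ ({0} : Set E) ≠ 0 := by
    rw [gaussianDistIntegral_zero hκ]
    have := pi_pos
    exact (ENNReal.ofReal_pos.2 (by positivity)).ne'
  have htop : gaussianDistIntegral κ ({0} : Set E) ≠ ⊤ := by
    rw [gaussianDistIntegral_zero hκ]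
    exact ENNReal.ofReal_ne_top
  rw [← ENNReal.le_div_iff_mul_le (Or.inl h0) (Or.inl htop)]
  have hk : ∀ k : ℕ, gaussianDistIntegral κ
      (range fun y : Fin (k + 1) × Fin (k + 1) => a y.1 + b y.2) ≤
      gaussianDistIntegral κ A * gaussianDistIntegral κ B /
        gaussianDistIntegral κ ({0} : Set E) := by
    intro k
    rw [ENNReal.le_div_iff_mul_le (Or.inl h0) (Or.inl htop)]
    refine (gaussianDistIntegral_range_add_mul_le hκ (fun i : Fin (k + 1) => a i)
      (fun i : Fin (k + 1) => b i)).trans (mul_le_mul' ?_ ?_)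
    · exact gaussianDistIntegral_mono hκ.le (range_nonempty _) (range_subset_iff.2 fun i => haA i)
    · exact gaussianDistIntegral_mono hκ.le (range_nonempty _) (range_subset_iff.2 fun i => hbB i)
  calc gaussianDistIntegral κ (A + B)
      = ∫⁻ x, Filter.liminf (fun k : ℕ => ENNReal.ofReal (Real.exp (-κ * Metric.infDist x
          (range fun y : Fin (k + 1) × Fin (k + 1) => a y.1 + b y.2) ^ 2))) Filter.atTop := by
        refine lintegral_congr fun x => (Filter.Tendsto.liminf_eq ?_).symm
        refine ENNReal.tendsto_ofReal ((Real.continuous_exp.tendsto _).comp ?_)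
        exact ((tendsto_infDist_range_add hA hB haA hbB hAa hBb x).pow 2).const_mul _
    _ ≤ Filter.liminf (fun k : ℕ => gaussianDistIntegral κ
          (range fun y : Fin (k + 1) × Fin (k + 1) => a y.1 + b y.2)) Filter.atTop :=
        lintegral_liminf_le fun k => measurable_ofReal_exp_infDist _
    _ ≤ _ := Filter.liminf_le_of_frequently_le' (Filter.Frequently.of_forall hk)

end DistIntegral

lemma wills_eq_gaussianDistIntegral (n : ℕ) (A : Set (EuclideanSpace ℝ (Fin n))) :
    wills n A = gaussianDistIntegral π A := rfl

lemma minimaxRegret_eq_log (n : ℕ) (A : Set (EuclideanSpace ℝ (Fin n))) :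
    minimaxRegret n A = ENNReal.log (ENNReal.ofReal ((2 * π) ^ (-(n : ℝ) / 2)) *
      gaussianDistIntegral (1 / 2) A) := by
  have := pi_pos
  rw [minimaxRegret, gaussianDistIntegral, ← lintegral_const_mul' _ _ ENNReal.ofReal_ne_top]
  congr 1
  refine lintegral_congr fun x => ?_
  rw [← ENNReal.ofReal_mul (by positivity)]
  congr 3
  ring

lemma minimaxRegret_neg (n : ℕ) (A : Set (EuclideanSpace ℝ (Fin n))) :
    minimaxRegret n (-A) = minimaxRegret n A := by
  rw [minimaxRegret_eq_log, minimaxRegret_eq_log, gaussianDistIntegral_neg]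

lemma minimaxRegret_add_le (n : ℕ) {A B : Set (EuclideanSpace ℝ (Fin n))}
    (hA : A.Nonempty) (hB : B.Nonempty) :
    minimaxRegret n (A + B) ≤ minimaxRegret n A + minimaxRegret n B := by
  simp only [minimaxRegret_eq_log, ← ENNReal.log_mul_add]
  refine ENNReal.log_monotone ?_
  set c := ENNReal.ofReal ((2 * π) ^ (-(n : ℝ) / 2)) with hc
  have h := gaussianDistIntegral_add_mul_le (κ := 1 / 2) (by norm_num) hA hB
  have h0 : c * gaussianDistIntegral (1 / 2) ({0} : Set (EuclideanSpace ℝ (Fin n))) = 1 := by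
    have := pi_pos
    rw [gaussianDistIntegral_zero (by norm_num), hc, ← ENNReal.ofReal_mul (by positivity),
      finrank_euclideanSpace_fin, show π / (1 / 2) = 2 * π by ring,
      ← Real.rpow_add (by positivity)]
    simp [neg_div]
  calc c * gaussianDistIntegral (1 / 2) (A + B)
      = c * gaussianDistIntegral (1 / 2) (A + B) *
          (c * gaussianDistIntegral (1 / 2) ({0} : Set (EuclideanSpace ℝ (Fin n)))) := by
        rw [h0, mul_one]
    _ = c * c * (gaussianDistIntegral (1 / 2) (A + B) *
          gaussianDistIntegral (1 / 2) ({0} : Set (EuclideanSpace ℝ (Fin n)))) := by ring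
    _ ≤ c * c * (gaussianDistIntegral (1 / 2) A * gaussianDistIntegral (1 / 2) B) := by gcongr
    _ = _ := by ring

/-- Sub-additivity under Minkowski sums: `W(A+B) ≤ W(A)·W(B)`; equivalently
`R*(A+B) ≤ R*(A) + R*(B)` in the extended reals; in particular `R*(A-A) ≤ 2·R*(A)`. -/
theorem wills_subadditive_minkowski (n : ℕ) (A B : Set (EuclideanSpace ℝ (Fin n)))
    (hA : A.Nonempty) (hB : B.Nonempty) :
    wills n (A + B) ≤ wills n A * wills n B ∧
    minimaxRegret n (A + B) ≤ minimaxRegret n A + minimaxRegret n B ∧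
    minimaxRegret n (A - A) ≤ ((2 : ℝ) : EReal) * minimaxRegret n A := by
  refine ⟨?_, minimaxRegret_add_le n hA hB, ?_⟩
  · have h := gaussianDistIntegral_add_mul_le pi_pos hA hB
    rw [gaussianDistIntegral_zero pi_pos, div_self pi_pos.ne'] at h
    simpa [wills_eq_gaussianDistIntegral] using h
  · have h2 : ((2 : ℝ) : EReal) * minimaxRegret n A = minimaxRegret n A + minimaxRegret n A := by
      rw [show ((2 : ℝ) : EReal) = 1 + 1 by norm_cast,
        EReal.right_distrib_of_nonneg zero_le_one zero_le_one, one_mul]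
    rw [h2, sub_eq_add_neg]
    simpa [minimaxRegret_neg] using minimaxRegret_add_le n hA hA.neg
end
end
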